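/- arXiv:0911.1272 — 7 statements merged into one kernel-verified Lean document; each statement's English description precedes it below -/
import Mathlib

section
/- For any ring R, the class GP(R)^⊥ is projectively resolving: it contains all projective R-modules, and for every short exact sequence 0 → X' → X → X'' → 0 of R-modules with X'' ∈ GP(R)^⊥, one has X' ∈ GP(R)^⊥ if and only if X ∈ GP(R)^⊥. -/
universe u

open CategoryTheory

/-- `extVanish R n M N` asserts that `Ext_R^n(M, N) = 0`. -/
def extVanish (R : Type u) [Ring R] (n : ℕ) (M N : ModuleCat.{u} R) : Prop :=
  letI := HasDerivedCategory.standard (ModuleCat.{u} R)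
  letI : HasExt.{u + 1} (ModuleCat.{u} R) := hasExt_of_hasDerivedCategory _
  Subsingleton (Abelian.Ext M N n)

/-- A module `G` is Gorenstein projective if there is an exact sequence of projective
modules `⋯ → P i → P (i+1) → ⋯` with `G ≅ Im (d 0)` which stays exact after applying
`Hom_R(−, Q)` for every projective module `Q`. -/
def IsGorensteinProjective (R : Type u) [Ring R] (G : ModuleCat.{u} R) : Prop :=
  ∃ (P : ℤ → ModuleCat.{u} R) (d : ∀ i : ℤ, P i →ₗ[R] P (i + 1)),
    (∀ i, Module.Projective R (P i)) ∧
    (∀ i, LinearMap.range (d i) = LinearMap.ker (d (i + 1))) ∧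
    Nonempty (G ≃ₗ[R] LinearMap.range (d 0)) ∧
    ∀ (Q : ModuleCat.{u} R), Module.Projective R Q →
      ∀ (i : ℤ) (f : P (i + 1) →ₗ[R] Q), f ∘ₗ d i = 0 →
        ∃ g : P (i + 1 + 1) →ₗ[R] Q, g ∘ₗ d (i + 1) = f

/-- A module `G` is Gorenstein injective if there is an exact sequence of injective
modules `⋯ → I i → I (i+1) → ⋯` with `G ≅ Im (d 0)` which stays exact after applying
`Hom_R(E, −)` for every injective module `E`. -/
def IsGorensteinInjective (R : Type u) [Ring R] (G : ModuleCat.{u} R) : Prop :=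
  ∃ (I : ℤ → ModuleCat.{u} R) (d : ∀ i : ℤ, I i →ₗ[R] I (i + 1)),
    (∀ i, Module.Injective R (I i)) ∧
    (∀ i, LinearMap.range (d i) = LinearMap.ker (d (i + 1))) ∧
    Nonempty (G ≃ₗ[R] LinearMap.range (d 0)) ∧
    ∀ (E : ModuleCat.{u} R), Module.Injective R E →
      ∀ (i : ℤ) (f : E →ₗ[R] I (i + 1)), d (i + 1) ∘ₗ f = 0 →
        ∃ g : E →ₗ[R] I i, d i ∘ₗ g = f

/-- The short complex attached to a short exact sequence of modules is short exact. -/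
lemma shortExact_of_range_eq_ker {R : Type u} [Ring R] {X₁ X₂ X₃ : ModuleCat.{u} R}
    (f : X₁ →ₗ[R] X₂) (g : X₂ →ₗ[R] X₃) (hf : Function.Injective f)
    (hg : Function.Surjective g) (hfg : LinearMap.range f = LinearMap.ker g) :
    (ShortComplex.moduleCatMkOfKerLERange (ModuleCat.ofHom f) (ModuleCat.ofHom g)
      hfg.le).ShortExact :=
  ModuleCat.shortComplex_shortExact _ (LinearMap.exact_iff.2 hfg.symm) hf hg

section Abelian

universe w v'

variable {C : Type*} [Category.{v'} C] [Abelian C] [HasExt.{w} C] {S : ShortComplex C}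

/-- If `0 → S.X₁ → S.X₂ → S.X₃ → 0` is exact with `S.X₂` projective, then `Ext¹(S.X₃, Y) = 0`
if and only if every morphism `S.X₁ ⟶ Y` extends to `S.X₂`. -/
lemma CategoryTheory.ShortComplex.ShortExact.subsingleton_ext_one_iff (hS : S.ShortExact)
    [Projective S.X₂] (Y : C) :
    Subsingleton (Abelian.Ext S.X₃ Y 1) ↔ ∀ f : S.X₁ ⟶ Y, ∃ g : S.X₂ ⟶ Y, S.f ≫ g = f := by
  constructor
  · intro h f
    obtain ⟨x, hx⟩ := Abelian.Ext.contravariant_sequence_exact₁ hS Y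
      (Abelian.Ext.mk₀ f) (add_zero 1) (h.elim _ _)
    obtain ⟨g, rfl⟩ := (Abelian.Ext.mk₀_bijective _ _).2 x
    rw [Abelian.Ext.mk₀_comp_mk₀] at hx
    exact ⟨g, (Abelian.Ext.mk₀_bijective _ _).1 hx⟩
  · intro h
    refine subsingleton_of_forall_eq 0 fun x ↦ ?_
    obtain ⟨y, rfl⟩ := Abelian.Ext.contravariant_sequence_exact₃ hS Y x
      (Abelian.Ext.eq_zero_of_projective _) (add_zero 1)
    obtain ⟨f, rfl⟩ := (Abelian.Ext.mk₀_bijective _ _).2 y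
    obtain ⟨g, rfl⟩ := h f
    rw [← Abelian.Ext.mk₀_comp_mk₀, hS.extClass_comp_assoc]

/-- If `Ext` from `M` in degree `n` vanishes on the ends of a short exact sequence, it vanishes
on the middle term. -/
lemma CategoryTheory.ShortComplex.ShortExact.subsingleton_ext_X₂ (hS : S.ShortExact) {M : C}
    {n : ℕ} (h₁ : Subsingleton (Abelian.Ext M S.X₁ n))
    (h₃ : Subsingleton (Abelian.Ext M S.X₃ n)) : Subsingleton (Abelian.Ext M S.X₂ n) := by
  refine subsingleton_of_forall_eq 0 fun x ↦ ?_
  obtain ⟨y, rfl⟩ := Abelian.Ext.covariant_sequence_exact₂ M hS x (h₃.elim _ _)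
  rw [h₁.elim y 0, Abelian.Ext.zero_comp]

/-- If `0 → S.X₁ → S.X₂ → S.X₃ → 0` is exact, `Ext¹(M, S.X₂) = 0` and every morphism
`M ⟶ S.X₃` lifts to `S.X₂`, then `Ext¹(M, S.X₁) = 0`. -/
lemma CategoryTheory.ShortComplex.ShortExact.subsingleton_ext_one_X₁ (hS : S.ShortExact) {M : C}
    (h₂ : Subsingleton (Abelian.Ext M S.X₂ 1))
    (hlift : ∀ φ : M ⟶ S.X₃, ∃ ψ : M ⟶ S.X₂, ψ ≫ S.g = φ) :
    Subsingleton (Abelian.Ext M S.X₁ 1) := by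
  refine subsingleton_of_forall_eq 0 fun x ↦ ?_
  obtain ⟨y, rfl⟩ := Abelian.Ext.covariant_sequence_exact₁ M hS x (h₂.elim _ _) (zero_add 1)
  obtain ⟨φ, rfl⟩ := (Abelian.Ext.mk₀_bijective _ _).2 y
  obtain ⟨ψ, rfl⟩ := hlift φ
  rw [← Abelian.Ext.mk₀_comp_mk₀, Abelian.Ext.comp_assoc_of_second_deg_zero, hS.comp_extClass,
    Abelian.Ext.comp_zero]

end Abelian

/-- If `0 → K → P → M → 0` is exact with `P` projective, then `Ext¹(M, Y) = 0` if and only if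
every map `K → Y` extends to `P`. -/
lemma extVanish_one_iff_of_projective {R : Type u} [Ring R] {K P M : ModuleCat.{u} R}
    (i : K →ₗ[R] P) (p : P →ₗ[R] M) (hi : Function.Injective i) (hp : Function.Surjective p)
    (hip : LinearMap.range i = LinearMap.ker p) (hP : Module.Projective R P)
    (Y : ModuleCat.{u} R) :
    extVanish R 1 M Y ↔ ∀ f : K →ₗ[R] Y, ∃ g : P →ₗ[R] Y, g ∘ₗ i = f := by
  let := HasDerivedCategory.standard (ModuleCat.{u} R)
  let : HasExt.{u + 1} (ModuleCat.{u} R) := hasExt_of_hasDerivedCategory _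
  have hS := shortExact_of_range_eq_ker i p hi hp hip
  have : Projective (ShortComplex.moduleCatMkOfKerLERange (ModuleCat.ofHom i)
      (ModuleCat.ofHom p) hip.le).X₂ := (IsProjective.iff_projective (R := R) P).1 hP
  refine (hS.subsingleton_ext_one_iff Y).trans ⟨fun h f ↦ ?_, fun h f ↦ ?_⟩
  · obtain ⟨g, hg⟩ := h (ModuleCat.ofHom f)
    exact ⟨g.hom, congrArg ModuleCat.Hom.hom hg⟩
  · obtain ⟨g, hg⟩ := h f.hom
    exact ⟨ModuleCat.ofHom g, ModuleCat.hom_ext hg⟩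

/-- If `Ext` from `M` in degree `n` vanishes on the ends of a short exact sequence of modules,
it vanishes on the middle term. -/
lemma extVanish_of_extension {R : Type u} [Ring R] {X₁ X₂ X₃ : ModuleCat.{u} R}
    (f : X₁ →ₗ[R] X₂) (g : X₂ →ₗ[R] X₃) (hf : Function.Injective f)
    (hg : Function.Surjective g) (hfg : LinearMap.range f = LinearMap.ker g)
    {n : ℕ} {M : ModuleCat.{u} R} (h₁ : extVanish R n M X₁) (h₃ : extVanish R n M X₃) :
    extVanish R n M X₂ := by
  let := HasDerivedCategory.standard (ModuleCat.{u} R)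
  let : HasExt.{u + 1} (ModuleCat.{u} R) := hasExt_of_hasDerivedCategory _
  exact (shortExact_of_range_eq_ker f g hf hg hfg).subsingleton_ext_X₂ h₁ h₃

/-- If `0 → X₁ → X₂ → X₃ → 0` is exact, `Ext¹(M, X₂) = 0` and every map `M → X₃` lifts to `X₂`,
then `Ext¹(M, X₁) = 0`. -/
lemma extVanish_one_of_lift {R : Type u} [Ring R] {X₁ X₂ X₃ : ModuleCat.{u} R}
    (f : X₁ →ₗ[R] X₂) (g : X₂ →ₗ[R] X₃) (hf : Function.Injective f)
    (hg : Function.Surjective g) (hfg : LinearMap.range f = LinearMap.ker g)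
    {M : ModuleCat.{u} R} (h₂ : extVanish R 1 M X₂)
    (hlift : ∀ φ : M →ₗ[R] X₃, ∃ ψ : M →ₗ[R] X₂, g ∘ₗ ψ = φ) :
    extVanish R 1 M X₁ := by
  let := HasDerivedCategory.standard (ModuleCat.{u} R)
  let : HasExt.{u + 1} (ModuleCat.{u} R) := hasExt_of_hasDerivedCategory _
  refine (shortExact_of_range_eq_ker f g hf hg hfg).subsingleton_ext_one_X₁ h₂ fun φ ↦ ?_
  obtain ⟨ψ, hψ⟩ := hlift φ.hom
  exact ⟨ModuleCat.ofHom ψ, ModuleCat.hom_ext hψ⟩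

namespace IsGorensteinProjective

/-- `Ext¹` from a Gorenstein projective module to a projective module vanishes. -/
lemma extVanish_one_of_projective {R : Type u} [Ring R] {G Q : ModuleCat.{u} R}
    (hG : IsGorensteinProjective R G) (hQ : Module.Projective R Q) : extVanish R 1 G Q := by
  obtain ⟨P, d, hP, hd, ⟨e⟩, hext⟩ := hG
  obtain ⟨i, ⟨e⟩⟩ : ∃ i : ℤ, Nonempty (G ≃ₗ[R] LinearMap.range (d (i + 1 + 1))) := by
    obtain ⟨i, hi⟩ : ∃ i : ℤ, i + 1 + 1 = 0 := ⟨-2, rfl⟩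
    exact ⟨i, by rw [hi]; exact ⟨e⟩⟩
  refine (extVanish_one_iff_of_projective
    (K := ModuleCat.of R (LinearMap.range (d (i + 1)))) (P := P (i + 1 + 1))
    (LinearMap.range (d (i + 1))).subtype (e.symm.toLinearMap ∘ₗ (d (i + 1 + 1)).rangeRestrict)
    (Submodule.injective_subtype _)
    (e.symm.surjective.comp (d (i + 1 + 1)).surjective_rangeRestrict)
    ?_ (hP _) Q).2 fun f ↦ ?_
  · rw [Submodule.range_subtype, LinearEquiv.ker_comp, LinearMap.ker_rangeRestrict, hd]
  · obtain ⟨g, hg⟩ := hext Q hQ i (f ∘ₗ (d (i + 1)).rangeRestrict) <| by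
      ext x
      have : (d (i + 1)).rangeRestrict (d i x) = 0 := Subtype.ext <|
        LinearMap.mem_ker.1 <| hd i ▸ LinearMap.mem_range_self (d i) x
      simp [this]
    refine ⟨g, LinearMap.ext ?_⟩
    rintro ⟨_, x, rfl⟩
    exact LinearMap.congr_fun hg x

/-- A Gorenstein projective module embeds in a projective module with Gorenstein projective
cokernel. -/
lemma exists_projective_embedding {R : Type u} [Ring R] {G : ModuleCat.{u} R}
    (hG : IsGorensteinProjective R G) :
    ∃ (P G' : ModuleCat.{u} R) (i : G →ₗ[R] P) (p : P →ₗ[R] G'), Module.Projective R P ∧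
      IsGorensteinProjective R G' ∧ Function.Injective i ∧ Function.Surjective p ∧
      LinearMap.range i = LinearMap.ker p := by
  obtain ⟨P, d, hP, hd, ⟨e⟩, hext⟩ := hG
  refine ⟨P (0 + 1), ModuleCat.of R (LinearMap.range (d (0 + 1))),
    (LinearMap.range (d 0)).subtype ∘ₗ e.toLinearMap, (d (0 + 1)).rangeRestrict, hP _,
    ⟨fun i ↦ P (i + 1), fun i ↦ d (i + 1), fun i ↦ hP _, fun i ↦ hd _, ⟨LinearEquiv.refl R _⟩,
      fun Q hQ i ↦ hext Q hQ (i + 1)⟩,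
    (Submodule.injective_subtype _).comp e.injective, (d (0 + 1)).surjective_rangeRestrict, ?_⟩
  rw [LinearEquiv.range_comp, Submodule.range_subtype, LinearMap.ker_rangeRestrict, hd]

end IsGorensteinProjective

/-- For any ring `R`, the class `GP(R)^⊥` is projectively resolving: it contains all
projective modules, and in every short exact sequence `0 → X₁ → X₂ → X₃ → 0` with
`X₃ ∈ GP(R)^⊥`, we have `X₁ ∈ GP(R)^⊥ ↔ X₂ ∈ GP(R)^⊥`. -/
theorem gpPerp_projectively_resolving (R : Type u) [Ring R] :
    (∀ P : ModuleCat.{u} R, Module.Projective R P →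
      ∀ G, IsGorensteinProjective R G → extVanish R 1 G P) ∧
    (∀ (X₁ X₂ X₃ : ModuleCat.{u} R) (f : X₁ →ₗ[R] X₂) (g : X₂ →ₗ[R] X₃),
      Function.Injective f → Function.Surjective g →
      LinearMap.range f = LinearMap.ker g →
      (∀ G, IsGorensteinProjective R G → extVanish R 1 G X₃) →
      ((∀ G, IsGorensteinProjective R G → extVanish R 1 G X₁) ↔
        (∀ G, IsGorensteinProjective R G → extVanish R 1 G X₂))) := by
  refine ⟨fun P hP G hG ↦ hG.extVanish_one_of_projective hP,
    fun X₁ X₂ X₃ f g hf hg hfg h₃ ↦ ⟨fun h₁ G hG ↦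
      extVanish_of_extension f g hf hg hfg (h₁ G hG) (h₃ G hG), fun h₂ G hG ↦
      extVanish_one_of_lift f g hf hg hfg (h₂ G hG) fun φ ↦ ?_⟩⟩
  obtain ⟨P, G', i, p, hP, hG', hi, hp, hip⟩ := hG.exists_projective_embedding
  obtain ⟨φ', hφ'⟩ := (extVanish_one_iff_of_projective i p hi hp hip hP X₃).1 (h₃ G' hG') φ
  obtain ⟨ψ, hψ⟩ := Module.projective_lifting_property g φ' hg
  exact ⟨ψ ∘ₗ i, by rw [← LinearMap.comp_assoc, hψ, hφ']⟩
end

section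
/- For any ring R, the class GP(R)^⊥ is injectively resolving: it contains all injective R-modules, and for every short exact sequence 0 → X' → X → X'' → 0 of R-modules with X' ∈ GP(R)^⊥, one has X'' ∈ GP(R)^⊥ if and only if X ∈ GP(R)^⊥. -/
universe u

open CategoryTheory

section ExtLemmas

open Abelian

universe v w

variable {C : Type u} [Category.{v} C] [Abelian C] [HasExt.{w} C] {S : ShortComplex C}

/-- Half-exactness of `Ext^n(X, -)`: vanishing on the outer terms gives vanishing in the middle. -/
lemma subsingleton_ext_middle (hS : S.ShortExact) (X : C) (n : ℕ)
    (h₁ : Subsingleton (Ext X S.X₁ n)) (h₃ : Subsingleton (Ext X S.X₃ n)) :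
    Subsingleton (Ext X S.X₂ n) := by
  refine subsingleton_of_forall_eq 0 fun x => ?_
  obtain ⟨y, rfl⟩ := Ext.covariant_sequence_exact₂ X hS x (Subsingleton.elim _ _)
  rw [Subsingleton.elim y 0, Ext.zero_comp]

/-- `Ext^n(X, X₂) = 0` and `Ext^(n+1)(X, X₁) = 0` imply `Ext^n(X, X₃) = 0`. -/
lemma subsingleton_ext_right (hS : S.ShortExact) (X : C) (n : ℕ)
    (h₂ : Subsingleton (Ext X S.X₂ n)) (h₁ : Subsingleton (Ext X S.X₁ (n + 1))) :
    Subsingleton (Ext X S.X₃ n) := by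
  refine subsingleton_of_forall_eq 0 fun x => ?_
  obtain ⟨y, rfl⟩ := Ext.covariant_sequence_exact₃ X hS x rfl (Subsingleton.elim _ _)
  rw [Subsingleton.elim y 0, Ext.zero_comp]

/-- Dimension shifting in the first variable along a projective object. -/
lemma subsingleton_ext_succ_of_projective (hS : S.ShortExact) [Projective S.X₂] (Y : C) (n : ℕ)
    (h₁ : Subsingleton (Ext S.X₁ Y n)) :
    Subsingleton (Ext S.X₃ Y (n + 1)) := by
  refine subsingleton_of_forall_eq 0 fun x => ?_
  obtain ⟨y, rfl⟩ := Ext.contravariant_sequence_exact₃ hS Y x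
    (Ext.eq_zero_of_projective _) (add_comm 1 n)
  rw [Subsingleton.elim y 0, Ext.comp_zero]

end ExtLemmas

/-- The differential `P i → P j` attached to a proof of `j = i + 1`. -/
def reindexedDifferential {R : Type u} [Ring R] {P : ℤ → ModuleCat.{u} R}
    (d : ∀ i : ℤ, P i →ₗ[R] P (i + 1)) (i j : ℤ) (h : j = i + 1) : P i →ₗ[R] P j :=
  h ▸ d i

/-- A Gorenstein projective module is a quotient of a projective module with Gorenstein
projective kernel. -/
lemma IsGorensteinProjective.exists_surjective {R : Type u} [Ring R] {G : ModuleCat.{u} R}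
    (hG : IsGorensteinProjective R G) :
    ∃ (P : ModuleCat.{u} R) (p : P →ₗ[R] G), Module.Projective R P ∧ Function.Surjective p ∧
      IsGorensteinProjective R (ModuleCat.of R (LinearMap.ker p)) := by
  obtain ⟨P, d, hP, hex, ⟨e⟩, hQ⟩ := hG
  have hex' : ∀ i j k (h : j = i + 1) (h' : k = j + 1),
      LinearMap.range (reindexedDifferential d i j h) =
        LinearMap.ker (reindexedDifferential d j k h') := by
    rintro i _ _ rfl rfl
    exact hex i
  have hQ' : ∀ (Q : ModuleCat.{u} R), Module.Projective R Q →
      ∀ i j k (h : j = i + 1) (h' : k = j + 1) (f : P j →ₗ[R] Q),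
        f ∘ₗ reindexedDifferential d i j h = 0 →
          ∃ g : P k →ₗ[R] Q, g ∘ₗ reindexedDifferential d j k h' = f := by
    rintro Q hQp i _ _ rfl rfl f hf
    exact hQ Q hQp i f hf
  have hker : LinearMap.ker (e.symm.toLinearMap ∘ₗ (d 0).rangeRestrict) =
      LinearMap.range (reindexedDifferential d (0 - 1) 0 (by simp)) := by
    rw [hex' (0 - 1) 0 (0 + 1) (by simp) rfl, LinearEquiv.ker_comp, LinearMap.ker_rangeRestrict]
    rfl
  refine ⟨P 0, e.symm.toLinearMap ∘ₗ (d 0).rangeRestrict, hP 0,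
    e.symm.surjective.comp (d 0).surjective_rangeRestrict,
    fun i => P (i - 1), fun i => reindexedDifferential d (i - 1) (i + 1 - 1) (by ring),
    fun i => hP _, fun i => hex' _ _ _ _ _, ⟨LinearEquiv.ofEq _ _ hker⟩,
    fun Q hQp i f hf => hQ' Q hQp _ _ _ _ _ f hf⟩

/-- For any ring `R`, the class `GP(R)^⊥` is injectively resolving: it contains all
injective modules, and in every short exact sequence `0 → X₁ → X₂ → X₃ → 0` with
`X₁ ∈ GP(R)^⊥`, we have `X₃ ∈ GP(R)^⊥ ↔ X₂ ∈ GP(R)^⊥`. -/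
theorem gpPerp_injectively_resolving (R : Type u) [Ring R] :
    (∀ I : ModuleCat.{u} R, Module.Injective R I →
      ∀ G, IsGorensteinProjective R G → extVanish R 1 G I) ∧
    (∀ (X₁ X₂ X₃ : ModuleCat.{u} R) (f : X₁ →ₗ[R] X₂) (g : X₂ →ₗ[R] X₃),
      Function.Injective f → Function.Surjective g →
      LinearMap.range f = LinearMap.ker g →
      (∀ G, IsGorensteinProjective R G → extVanish R 1 G X₁) →
      ((∀ G, IsGorensteinProjective R G → extVanish R 1 G X₃) ↔
        (∀ G, IsGorensteinProjective R G → extVanish R 1 G X₂))) := by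
  let := HasDerivedCategory.standard (ModuleCat.{u} R)
  let : HasExt.{u + 1} (ModuleCat.{u} R) := hasExt_of_hasDerivedCategory _
  refine ⟨fun I hI G _ => ?_, fun X₁ X₂ X₃ f g hf hg hfg h₁ => ?_⟩
  · have : CategoryTheory.Injective I := Module.injective_object_of_injective_module R I
    exact Abelian.Ext.subsingleton_of_injective G I 0
  · have hS : (ModuleCat.shortComplexOfCompEqZero f g
        (LinearMap.range_le_ker_iff.mp hfg.le)).ShortExact :=
      ModuleCat.shortComplex_shortExact _ (LinearMap.exact_iff.mpr hfg.symm) hf hg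
    refine ⟨fun h₃ G hG => subsingleton_ext_middle hS G 1 (h₁ G hG) (h₃ G hG),
      fun h₂ G hG => subsingleton_ext_right hS G 1 (h₂ G hG) ?_⟩
    obtain ⟨P, p, hP, hp, hK⟩ := hG.exists_surjective
    have : Projective P := (IsProjective.iff_projective P).mp hP
    exact subsingleton_ext_succ_of_projective (LinearMap.shortExact_shortComplexKer hp) X₁ 1
      (h₁ _ hK)
end

section
/- For any ring R, an R-module is projective if and only if it is both Gorenstein projective and belongs to GP(R)^⊥; that is, P(R) = GP(R) ∩ GP(R)^⊥. -/
universe u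

open CategoryTheory

namespace CategoryTheory.Abelian.Ext

universe w v v'

variable {C : Type v'} [Category.{v} C] [Abelian C] [HasExt.{w} C]
  {S : ShortComplex C} (hS : S.ShortExact) {M : C}

include hS in
theorem exists_extension_of_subsingleton_ext_one (h : Subsingleton (Ext S.X₃ M 1))
    (f : S.X₁ ⟶ M) : ∃ g : S.X₂ ⟶ M, S.f ≫ g = f := by
  obtain ⟨x, hx⟩ := contravariant_sequence_exact₁ hS M (mk₀ f) (add_zero 1)
    (Subsingleton.elim _ _)
  obtain ⟨g, rfl⟩ := (mk₀_bijective _ _).surjective x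
  refine ⟨g, (mk₀_bijective _ _).injective ?_⟩
  rwa [mk₀_comp_mk₀] at hx

include hS in
theorem subsingleton_ext_one_of_exists_extension [Projective S.X₂]
    (h : ∀ f : S.X₁ ⟶ M, ∃ g : S.X₂ ⟶ M, S.f ≫ g = f) :
    Subsingleton (Ext S.X₃ M 1) := by
  refine subsingleton_of_forall_eq 0 fun x => ?_
  obtain ⟨y, rfl⟩ := contravariant_sequence_exact₃ hS M x (eq_zero_of_projective _)
    (add_zero 1)
  obtain ⟨f, rfl⟩ := (mk₀_bijective _ _).surjective y
  obtain ⟨g, rfl⟩ := h f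
  rw [← mk₀_comp_mk₀, hS.extClass_comp_assoc]

end CategoryTheory.Abelian.Ext

theorem IsGorensteinProjective.of_projective {R : Type u} [Ring R] (M : ModuleCat.{u} R)
    [Module.Projective R M] : IsGorensteinProjective R M := by
  refine ⟨fun _ => ModuleCat.of R (M × M), fun _ => LinearMap.inl R M M ∘ₗ LinearMap.snd R M M,
    fun _ => inferInstanceAs (Module.Projective R (M × M)), fun _ => ?_, ⟨?_⟩, ?_⟩
  · ext ⟨a, b⟩
    simp only [LinearMap.mem_range, LinearMap.mem_ker]
    constructor
    · rintro ⟨⟨x, y⟩, h⟩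
      have : (y, (0 : M)) = (a, b) := h
      cases this
      rfl
    · intro h
      have hb : b = 0 := congrArg Prod.fst h
      exact ⟨(0, a), by subst hb; rfl⟩
  · exact (LinearEquiv.ofInjective (LinearMap.inl R M M) LinearMap.inl_injective).trans
      (LinearEquiv.ofEq _ _
        (LinearMap.range_comp_of_range_eq_top _ (LinearMap.range_eq_top.2 Prod.snd_surjective)).symm)
  · intro Q _ _ f hf
    refine ⟨f ∘ₗ (LinearMap.inr R M M ∘ₗ LinearMap.fst R M M : M × M →ₗ[R] M × M), ?_⟩
    refine LinearMap.ext fun ⟨x, y⟩ => ?_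
    have h0 : f (x, 0) = 0 := LinearMap.congr_fun hf (0, x)
    have h1 : f ((x, 0) + (0, y)) = f (x, 0) + f (0, y) := f.map_add _ _
    rw [h0, zero_add, Prod.mk_add_mk, add_zero, zero_add] at h1
    exact h1.symm

theorem IsGorensteinProjective.extVanish_one {R : Type u} [Ring R] {G : ModuleCat.{u} R}
    (hG : IsGorensteinProjective R G) (M : ModuleCat.{u} R) [Module.Projective R M] :
    extVanish R 1 G M := by
  obtain ⟨P, d, hP, hd, e₀, hQ⟩ := hG
  obtain ⟨i, ⟨e⟩⟩ : ∃ i : ℤ, Nonempty (G ≃ₗ[R] LinearMap.range (d (i + 1 + 1))) :=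
    ⟨-2, (by norm_num : (0 : ℤ) = -2 + 1 + 1) ▸ e₀⟩
  let _ := HasDerivedCategory.standard (ModuleCat.{u} R)
  let _ : HasExt.{u + 1} (ModuleCat.{u} R) := hasExt_of_hasDerivedCategory _
  let p : P (i + 1 + 1) →ₗ[R] G := e.symm.toLinearMap ∘ₗ (d (i + 1 + 1)).rangeRestrict
  have hp : Function.Surjective p :=
    e.symm.surjective.comp (d (i + 1 + 1)).surjective_rangeRestrict
  have hker : ∀ x, p x = 0 ↔ d (i + 1 + 1) x = 0 := fun x => by
    simp [p, Subtype.ext_iff]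
  have : Projective (P (i + 1 + 1)) :=
    (IsProjective.iff_projective (R := R) (P (i + 1 + 1))).1 (hP _)
  have : Projective p.shortComplexKer.X₂ := this
  refine Abelian.Ext.subsingleton_ext_one_of_exists_extension
    (LinearMap.shortExact_shortComplexKer hp) fun f => ?_
  have hmem : ∀ y : P (i + 1), d (i + 1) y ∈ LinearMap.ker p := fun y =>
    (hker _).2 (LinearMap.mem_ker.1 ((hd (i + 1)).le ⟨y, rfl⟩))
  let φ : LinearMap.ker p →ₗ[R] M := f.hom
  let k : P (i + 1) →ₗ[R] LinearMap.ker p := LinearMap.codRestrict _ (d (i + 1)) hmem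
  obtain ⟨g, hg⟩ := hQ M inferInstance i (φ ∘ₗ k) (by
    refine LinearMap.ext fun z => ?_
    have : k (d i z) = 0 := Subtype.ext (LinearMap.mem_ker.1 ((hd i).le ⟨z, rfl⟩))
    exact (congrArg φ this).trans (map_zero φ))
  refine ⟨ModuleCat.ofHom (X := P (i + 1 + 1)) g, ?_⟩
  ext ⟨x, hx⟩
  obtain ⟨y, rfl⟩ := (hd (i + 1)).ge (LinearMap.mem_ker.2 ((hker x).1 hx))
  exact LinearMap.congr_fun hg y

/-- A Gorenstein projective module embeds in a projective module with Gorenstein projective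
cokernel. -/
theorem IsGorensteinProjective.exists_shortExact {R : Type u} [Ring R] {M : ModuleCat.{u} R}
    (hM : IsGorensteinProjective R M) :
    ∃ (P G : ModuleCat.{u} R) (f : M →ₗ[R] P) (g : P →ₗ[R] G), Module.Projective R P ∧
      IsGorensteinProjective R G ∧ Function.Injective f ∧ Function.Exact f g ∧
      Function.Surjective g := by
  obtain ⟨P, d, hP, hd, ⟨e⟩, hQ⟩ := hM
  refine ⟨P (0 + 1), ModuleCat.of R (LinearMap.range (d (0 + 1))),
    (LinearMap.range (d 0)).subtype ∘ₗ e.toLinearMap, (d (0 + 1)).rangeRestrict, hP _,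
    ⟨fun i => P (i + 1), fun i => d (i + 1), fun i => hP _, fun i => hd _,
      ⟨LinearEquiv.refl R _⟩, fun Q hQ' i => hQ Q hQ' (i + 1)⟩,
    (Submodule.subtype_injective _).comp e.injective, ?_, LinearMap.surjective_rangeRestrict _⟩
  rw [LinearMap.exact_iff, LinearMap.ker_rangeRestrict, LinearEquiv.range_comp,
    Submodule.range_subtype, hd]

/-- For any ring `R`, `P(R) = GP(R) ∩ GP(R)^⊥`. -/
theorem projective_iff_gorensteinProjective_and_mem_rightPerp (R : Type u) [Ring R]
    (M : ModuleCat.{u} R) :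
    Module.Projective R M ↔
      (IsGorensteinProjective R M ∧
        ∀ G, IsGorensteinProjective R G → extVanish R 1 G M) := by
  refine ⟨fun _ => ⟨.of_projective M, fun G hG => hG.extVanish_one M⟩, fun ⟨hM, hperp⟩ => ?_⟩
  obtain ⟨P, G, f, g, hP, hG, hf, hfg, hg⟩ := hM.exists_shortExact
  let _ := HasDerivedCategory.standard (ModuleCat.{u} R)
  let _ : HasExt.{u + 1} (ModuleCat.{u} R) := hasExt_of_hasDerivedCategory _
  let S : ShortComplex (ModuleCat.{u} R) :=
    .mk (ModuleCat.ofHom f) (ModuleCat.ofHom g) (by ext x; exact hfg.apply_apply_eq_zero x)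
  have hS : S.ShortExact := ModuleCat.shortComplex_shortExact S hfg hf hg
  obtain ⟨s, hs⟩ := Abelian.Ext.exists_extension_of_subsingleton_ext_one hS (hperp G hG) (𝟙 M)
  exact Module.Projective.of_split f s.hom (congrArg ModuleCat.Hom.hom hs)
end

section
/- For any ring R, every R-module M with finite injective dimension belongs to GP(R)^⊥; that is, if id_R(M) < ∞ then Ext¹_R(G, M) = 0 for every Gorenstein projective R-module G. -/
universe u

open CategoryTheory

/-- `projDimLE R n M` means that `M` admits a projective resolution of length at most `n`,
i.e. the projective dimension of `M` is at most `n`. -/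
def projDimLE (R : Type u) [Ring R] : ℕ → ModuleCat.{u} R → Prop
  | 0, M => Module.Projective R M
  | n + 1, M => ∃ (K P : ModuleCat.{u} R) (f : K →ₗ[R] P) (g : P →ₗ[R] M),
      Module.Projective R P ∧ Function.Injective f ∧ Function.Surjective g ∧
      LinearMap.range f = LinearMap.ker g ∧ projDimLE R n K

/-- `injDimLE R n M` means that `M` admits an injective resolution of length at most `n`,
i.e. the injective dimension of `M` is at most `n`. -/
def injDimLE (R : Type u) [Ring R] : ℕ → ModuleCat.{u} R → Prop
  | 0, M => Module.Injective R M
  | n + 1, M => ∃ (I C : ModuleCat.{u} R) (f : M →ₗ[R] I) (g : I →ₗ[R] C),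
      Module.Injective R I ∧ Function.Injective f ∧ Function.Surjective g ∧
      LinearMap.range f = LinearMap.ker g ∧ injDimLE R n C

open Abelian in
/-- Dimension shifting along `0 → range f → P → range g → 0` with `P` projective. -/
lemma subsingleton_ext_range_of_succ {R : Type u} [Ring R] [HasExt.{u + 1} (ModuleCat.{u} R)]
    {A P B : ModuleCat.{u} R} [Module.Projective R P] (f : A →ₗ[R] P) (g : P →ₗ[R] B)
    (h : LinearMap.range f = LinearMap.ker g) (M : ModuleCat.{u} R) (j : ℕ)
    (hg : Subsingleton (Ext (ModuleCat.of R (LinearMap.range g)) M (j + 2))) :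
    Subsingleton (Ext (ModuleCat.of R (LinearMap.range f)) M (j + 1)) := by
  let S : ShortComplex (ModuleCat.{u} R) :=
    ShortComplex.moduleCatMk (LinearMap.range f).subtype g.rangeRestrict (by
      ext ⟨x, hx⟩
      rw [h] at hx
      simpa using hx)
  have hS : S.ShortExact := ModuleCat.shortComplex_shortExact S
    (LinearMap.exact_iff.mpr
      (g.ker_rangeRestrict.trans (h.symm.trans (LinearMap.range f).range_subtype.symm)))
    (Submodule.injective_subtype _) g.surjective_rangeRestrict
  have : Projective S.X₂ := inferInstanceAs (Projective (ModuleCat.of R P))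
  refine subsingleton_of_forall_eq 0 fun x ↦ ?_
  obtain ⟨y, rfl⟩ := Ext.contravariant_sequence_exact₁ hS M x (n₁ := j + 2) (by lia)
    (hg.elim _ _)
  rw [y.eq_zero_of_projective, Ext.comp_zero]
  rfl

lemma injDimLE.hasInjectiveDimensionLE {R : Type u} [Ring R] {n : ℕ} {M : ModuleCat.{u} R}
    (h : injDimLE R n M) : HasInjectiveDimensionLE M n := by
  induction n generalizing M with
  | zero =>
    have : Module.Injective R M := h
    exact injective_iff_hasInjectiveDimensionLT_one.mp
      (Module.injective_object_of_injective_module R M)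
  | succ n ih =>
    obtain ⟨I, C, f, g, hI, hf, hg, hfg, hC⟩ := h
    have : Injective I := Module.injective_object_of_injective_module R I
    let S : ShortComplex (ModuleCat.{u} R) :=
      ShortComplex.moduleCatMk f g (LinearMap.range_le_ker_iff.mp hfg.le)
    have hS : S.ShortExact := ModuleCat.shortComplex_shortExact S
      (LinearMap.exact_iff.mpr hfg.symm) hf hg
    exact (hS.hasInjectiveDimensionLT_X₃_iff n this).mp (ih hC)

/-- `Ext¹(G, M)` vanishes for `G` Gorenstein projective and `M` of finite injective dimension:
shift dimensions along the part of the complete resolution to the right of `G`. -/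
lemma IsGorensteinProjective.subsingleton_ext_one {R : Type u} [Ring R]
    [HasExt.{u + 1} (ModuleCat.{u} R)] {G : ModuleCat.{u} R} (hG : IsGorensteinProjective R G)
    (M : ModuleCat.{u} R) (n : ℕ) [HasInjectiveDimensionLE M n] :
    Subsingleton (Abelian.Ext G M 1) := by
  obtain ⟨P, d, hP, hd, ⟨e⟩, -⟩ := hG
  have ext_range (k : ℕ) : ∀ (i : ℤ) (j : ℕ), n ≤ j + k →
      Subsingleton (Abelian.Ext (ModuleCat.of R (LinearMap.range (d i))) M (j + 1)) := by
    induction k with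
    | zero => exact fun i j hj ↦ HasInjectiveDimensionLT.subsingleton M (n + 1) _ (by lia) _
    | succ k ih =>
      exact fun i j hj ↦ subsingleton_ext_range_of_succ (d i) (d (i + 1)) (hd i) M j
        (ih (i + 1) (j + 1) (by lia))
  have := ext_range n 0 0 (by lia)
  refine subsingleton_of_forall_eq 0 fun x ↦ ?_
  rw [← Abelian.Ext.mk₀_id_comp x, ← e.toModuleIso.hom_inv_id, ← Abelian.Ext.mk₀_comp_mk₀_assoc,
    Subsingleton.elim ((Abelian.Ext.mk₀ _).comp x _) 0, Abelian.Ext.comp_zero]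

/-- Every module of finite injective dimension belongs to `GP(R)^⊥`. -/
theorem mem_gpPerp_of_finite_injDim (R : Type u) [Ring R]
    (M : ModuleCat.{u} R) (hfin : ∃ n : ℕ, injDimLE R n M) :
    ∀ G, IsGorensteinProjective R G → extVanish R 1 G M := by
  obtain ⟨n, hn⟩ := hfin
  have := hn.hasInjectiveDimensionLE
  intro G hG
  let := HasDerivedCategory.standard (ModuleCat.{u} R)
  let : HasExt.{u + 1} (ModuleCat.{u} R) := hasExt_of_hasDerivedCategory _
  exact hG.subsingleton_ext_one M n
end

section
/- For any ring R, every R-module M with finite projective dimension belongs to ^⊥GI(R); that is, if pd_R(M) < ∞ then Ext¹_R(M, G) = 0 for every Gorenstein injective R-module G. -/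
universe u

open CategoryTheory

open Abelian

theorem projDimLE.hasProjectiveDimensionLE {R : Type u} [Ring R] {n : ℕ} {M : ModuleCat.{u} R}
    (h : projDimLE R n M) : HasProjectiveDimensionLE M n := by
  induction n generalizing M with
  | zero =>
    have : Module.Projective R M := h
    rw [← projective_iff_hasProjectiveDimensionLE_zero]
    exact (IsProjective.iff_projective M).1 ‹_›
  | succ n ih =>
    obtain ⟨K, P, f, g, hP, hf, hg, hfg, hK⟩ := h
    have hexact : Function.Exact f g := LinearMap.exact_iff.2 hfg.symm
    have hS : (ModuleCat.shortComplexOfCompEqZero f g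
        hexact.linearMap_comp_eq_zero).ShortExact :=
      ModuleCat.shortComplex_shortExact _ hexact hf hg
    have : Projective P := (IsProjective.iff_projective P).1 ‹_›
    exact (hS.hasProjectiveDimensionLT_X₃_iff n this).2 (ih hK)

/-- Dimension shifting along a short exact sequence with injective middle term: vanishing of
`Ext` in degree `n + 2` at the left term gives vanishing in degree `n + 1` at the right term. -/
theorem subsingleton_ext_of_shortExact_injective {C : Type*} [Category* C] [Abelian C]
    [HasExt C] {S : ShortComplex C} (hS : S.ShortExact) [Injective S.X₂] (X : C) (n : ℕ)
    (h : Subsingleton (Ext X S.X₁ (n + 2))) : Subsingleton (Ext X S.X₃ (n + 1)) := by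
  refine subsingleton_of_forall_eq 0 fun x ↦ ?_
  obtain ⟨y, rfl⟩ := Ext.covariant_sequence_exact₃ X hS x rfl (Subsingleton.elim _ _)
  rw [y.eq_zero_of_injective, Ext.zero_comp]

theorem subsingleton_ext_of_iso {C : Type*} [Category* C] [Abelian C] [HasExt C]
    {Y Y' : C} (e : Y ≅ Y') (X : C) (n : ℕ) (h : Subsingleton (Ext X Y n)) :
    Subsingleton (Ext X Y' n) := by
  refine subsingleton_of_forall_eq 0 fun x ↦ ?_
  have hx : (x.comp (Ext.mk₀ e.inv) (add_zero n)).comp (Ext.mk₀ e.hom) (add_zero n) = x := by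
    simp
  rw [← hx, Subsingleton.elim (x.comp (Ext.mk₀ e.inv) (add_zero n)) 0, Ext.zero_comp]

/-- In an exact sequence of injective modules, the ranges of the differentials have vanishing
`Ext` from every module of finite projective dimension. -/
theorem subsingleton_ext_range_of_exact_injective {R : Type u} [Ring R] [HasExt (ModuleCat.{u} R)]
    {I : ℤ → ModuleCat.{u} R} {d : ∀ i : ℤ, I i →ₗ[R] I (i + 1)}
    (hI : ∀ i, Module.Injective R (I i))
    (hd : ∀ i, LinearMap.range (d i) = LinearMap.ker (d (i + 1)))
    (M : ModuleCat.{u} R) (n : ℕ) [HasProjectiveDimensionLE M n] (i : ℤ) (k : ℕ) :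
    Subsingleton (Ext M (ModuleCat.of R (LinearMap.range (d i))) (k + 1)) := by
  by_cases hk : n ≤ k
  · exact HasProjectiveDimensionLT.subsingleton M (n + 1) (k + 1) (by lia) _
  · obtain ⟨j, rfl⟩ : ∃ j : ℤ, i = j + 1 := ⟨i - 1, by ring⟩
    have hexact : Function.Exact (LinearMap.range (d j)).subtype (d (j + 1)).rangeRestrict := by
      rw [LinearMap.exact_iff, LinearMap.ker_rangeRestrict, Submodule.range_subtype, hd]
    have hS : (ModuleCat.shortComplexOfCompEqZero _ _
        hexact.linearMap_comp_eq_zero).ShortExact :=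
      ModuleCat.shortComplex_shortExact _ hexact (Submodule.injective_subtype _)
        (LinearMap.surjective_rangeRestrict _)
    have : Injective (I (j + 1)) :=
      Module.injective_object_of_injective_module R _ (inj := hI (j + 1))
    exact subsingleton_ext_of_shortExact_injective hS M k
      (subsingleton_ext_range_of_exact_injective hI hd M n j (k + 1))
termination_by n - k

/-- Every module of finite projective dimension belongs to `^⊥GI(R)`. -/
theorem mem_giLeftPerp_of_finite_projDim (R : Type u) [Ring R]
    (M : ModuleCat.{u} R) (hfin : ∃ n : ℕ, projDimLE R n M) :
    ∀ G, IsGorensteinInjective R G → extVanish R 1 M G := by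
  obtain ⟨n, hn⟩ := hfin
  rintro G ⟨I, d, hI, hd, ⟨e⟩, -⟩
  have := hn.hasProjectiveDimensionLE
  let := HasDerivedCategory.standard (ModuleCat.{u} R)
  let : HasExt.{u + 1} (ModuleCat.{u} R) := hasExt_of_hasDerivedCategory _
  exact subsingleton_ext_of_iso e.symm.toModuleIso M 1
    (subsingleton_ext_range_of_exact_injective hI hd M n 0 0)
end

section
/- If R is a ring with l.Ggldim(R) < ∞, then the pair (GP(R), GP(R)^⊥) is a complete hereditary cotorsion theory: ^⊥(GP(R)^⊥) = GP(R), every R-module has a special GP(R)-precover and a special GP(R)^⊥-preenvelope, and for every short exact sequence 0 → L' → L → L'' → 0 with L, L'' ∈ GP(R) one has L' ∈ GP(R). -/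
universe u

open CategoryTheory

/-- `gpdLE R n M` means that `M` admits a resolution `0 → Gₙ → ⋯ → G₀ → M → 0` by
Gorenstein projective modules, i.e. the Gorenstein projective dimension of `M` is at
most `n`. -/
def gpdLE (R : Type u) [Ring R] : ℕ → ModuleCat.{u} R → Prop
  | 0, M => IsGorensteinProjective R M
  | n + 1, M => ∃ (K G : ModuleCat.{u} R) (f : K →ₗ[R] G) (g : G →ₗ[R] M),
      IsGorensteinProjective R G ∧ Function.Injective f ∧ Function.Surjective g ∧
      LinearMap.range f = LinearMap.ker g ∧ gpdLE R n K

/-- `gidLE R n M` means that `M` admits a coresolution `0 → M → G⁰ → ⋯ → Gⁿ → 0` by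
Gorenstein injective modules, i.e. the Gorenstein injective dimension of `M` is at
most `n`. -/
def gidLE (R : Type u) [Ring R] : ℕ → ModuleCat.{u} R → Prop
  | 0, M => IsGorensteinInjective R M
  | n + 1, M => ∃ (G C : ModuleCat.{u} R) (f : M →ₗ[R] G) (g : G →ₗ[R] C),
      IsGorensteinInjective R G ∧ Function.Injective f ∧ Function.Surjective g ∧
      LinearMap.range f = LinearMap.ker g ∧ gidLE R n C


/-- A short exact sequence `0 → A → B → C → 0` of modules. -/
structure ShortExactSeq {R : Type u} [Ring R] {A B C : ModuleCat.{u} R}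
    (f : A →ₗ[R] B) (g : B →ₗ[R] C) : Prop where
  inj : Function.Injective f
  surj : Function.Surjective g
  exact : LinearMap.range f = LinearMap.ker g

namespace ShortExactSeq

variable {R : Type u} [Ring R] {A B C : ModuleCat.{u} R}
  {f : A →ₗ[R] B} {g : B →ₗ[R] C}

lemma comp_eq_zero (S : ShortExactSeq f g) : g ∘ₗ f = 0 :=
  LinearMap.range_le_ker_iff.1 S.exact.le

lemma apply_apply (S : ShortExactSeq f g) (a : A) : g (f a) = 0 :=
  LinearMap.congr_fun S.comp_eq_zero a

lemma exists_of_apply_eq_zero (S : ShortExactSeq f g) {b : B} (hb : g b = 0) :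
    ∃ a, f a = b :=
  S.exact.ge hb

lemma shortExact (S : ShortExactSeq f g) :
    (ShortComplex.moduleCatMk f g S.comp_eq_zero).ShortExact where
  exact := (ShortComplex.moduleCat_exact_iff_range_eq_ker _).2 S.exact
  mono_f := (ModuleCat.mono_iff_injective _).2 S.inj
  epi_g := (ModuleCat.epi_iff_surjective _).2 S.surj

lemma of_projective_presentation (M : ModuleCat.{u} R) :
    ∃ (K P : ModuleCat.{u} R) (f : K →ₗ[R] P) (g : P →ₗ[R] M),
      Module.Projective R P ∧ ShortExactSeq f g := by
  let g : (M →₀ R) →ₗ[R] M := Finsupp.linearCombination R id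
  exact ⟨ModuleCat.of R (LinearMap.ker g), ModuleCat.of R (M →₀ R),
    (LinearMap.ker g).subtype, g, inferInstanceAs (Module.Projective R (M →₀ R)),
    Subtype.val_injective, Finsupp.linearCombination_id_surjective R M,
    Submodule.range_subtype _⟩

lemma of_injective (hf : Function.Injective f) :
    ShortExactSeq (C := ModuleCat.of R (B ⧸ LinearMap.range f)) f (LinearMap.range f).mkQ where
  inj := hf
  surj := Submodule.mkQ_surjective _
  exact := (Submodule.ker_mkQ _).symm

/-- A map killing the image of `f` factors through `g`. -/
lemma exists_desc (S : ShortExactSeq f g) {N : Type*} [AddCommGroup N] [Module R N]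
    (h : B →ₗ[R] N) (hh : h ∘ₗ f = 0) : ∃ k : C →ₗ[R] N, k ∘ₗ g = h := by
  refine ⟨(LinearMap.ker g).liftQ h (S.exact ▸ LinearMap.range_le_ker_iff.2 hh) ∘ₗ
    (g.quotKerEquivOfSurjective S.surj).symm.toLinearMap, ?_⟩
  ext b
  have : (g.quotKerEquivOfSurjective S.surj).symm (g b) = (LinearMap.ker g).mkQ b := by
    rw [LinearEquiv.symm_apply_eq]; rfl
  simp [this]

open Abelian in
lemma extVanish_left (S : ShortExactSeq f g) {N : ModuleCat.{u} R} {n : ℕ}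
    (hB : extVanish R n B N) (hC : extVanish R (n + 1) C N) : extVanish R n A N := by
  let := HasDerivedCategory.standard (ModuleCat.{u} R)
  let : HasExt.{u + 1} (ModuleCat.{u} R) := hasExt_of_hasDerivedCategory _
  replace hB : Subsingleton (Ext B N n) := hB
  replace hC : Subsingleton (Ext C N (n + 1)) := hC
  refine subsingleton_of_forall_eq (0 : Ext A N n) fun x => ?_
  obtain ⟨y, rfl⟩ := Ext.contravariant_sequence_exact₁ S.shortExact N x (add_comm 1 n)
    (hC.elim _ _)
  obtain rfl : y = 0 := hB.elim y 0
  rw [Ext.comp_zero]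
  rfl

open Abelian in
lemma extVanish_mid (S : ShortExactSeq f g) {N : ModuleCat.{u} R} {n : ℕ}
    (hA : extVanish R n A N) (hC : extVanish R n C N) : extVanish R n B N := by
  let := HasDerivedCategory.standard (ModuleCat.{u} R)
  let : HasExt.{u + 1} (ModuleCat.{u} R) := hasExt_of_hasDerivedCategory _
  replace hA : Subsingleton (Ext A N n) := hA
  replace hC : Subsingleton (Ext C N n) := hC
  refine subsingleton_of_forall_eq (0 : Ext B N n) fun x => ?_
  obtain ⟨y, rfl⟩ := Ext.contravariant_sequence_exact₂ S.shortExact N x (hA.elim _ _)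
  obtain rfl : y = 0 := hC.elim y 0
  rw [Ext.comp_zero]
  rfl

open Abelian in
lemma extVanish_right (S : ShortExactSeq f g) {N : ModuleCat.{u} R} {n : ℕ}
    (hA : extVanish R n A N) (hB : extVanish R (n + 1) B N) : extVanish R (n + 1) C N := by
  let := HasDerivedCategory.standard (ModuleCat.{u} R)
  let : HasExt.{u + 1} (ModuleCat.{u} R) := hasExt_of_hasDerivedCategory _
  replace hA : Subsingleton (Ext A N n) := hA
  replace hB : Subsingleton (Ext B N (n + 1)) := hB
  refine subsingleton_of_forall_eq (0 : Ext C N (n + 1)) fun x => ?_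
  obtain ⟨y, rfl⟩ := Ext.contravariant_sequence_exact₃ S.shortExact N x (hB.elim _ _)
    (add_comm 1 n)
  obtain rfl : y = 0 := hA.elim y 0
  rw [Ext.comp_zero]
  rfl

open Abelian in
lemma extVanish_covariant_right (S : ShortExactSeq f g) {G : ModuleCat.{u} R} {n : ℕ}
    (hB : extVanish R n G B) (hA : extVanish R (n + 1) G A) : extVanish R n G C := by
  let := HasDerivedCategory.standard (ModuleCat.{u} R)
  let : HasExt.{u + 1} (ModuleCat.{u} R) := hasExt_of_hasDerivedCategory _
  replace hA : Subsingleton (Ext G A (n + 1)) := hA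
  replace hB : Subsingleton (Ext G B n) := hB
  refine subsingleton_of_forall_eq (0 : Ext G C n) fun x => ?_
  obtain ⟨y, rfl⟩ := Ext.covariant_sequence_exact₃ G S.shortExact x rfl (hA.elim _ _)
  obtain rfl : y = 0 := hB.elim y 0
  rw [Ext.zero_comp]
  rfl

open Abelian in
/-- If `Ext¹(C, N) = 0` then every map `A → N` extends to `B`. -/
lemma exists_extend (S : ShortExactSeq f g) {N : ModuleCat.{u} R} (hC : extVanish R 1 C N)
    (h : A →ₗ[R] N) : ∃ k : B →ₗ[R] N, k ∘ₗ f = h := by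
  let := HasDerivedCategory.standard (ModuleCat.{u} R)
  let : HasExt.{u + 1} (ModuleCat.{u} R) := hasExt_of_hasDerivedCategory _
  replace hC : Subsingleton (Ext C N 1) := hC
  obtain ⟨y, hy⟩ := Ext.contravariant_sequence_exact₁ S.shortExact N
    (Ext.mk₀ (ModuleCat.ofHom h)) (add_zero 1) (hC.elim _ _)
  obtain ⟨k, rfl⟩ := (Ext.mk₀_bijective _ _).surjective y
  rw [Ext.mk₀_comp_mk₀] at hy
  exact ⟨k.hom, congrArg ModuleCat.Hom.hom ((Ext.mk₀_bijective _ _).injective hy)⟩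

open Abelian in
/-- If `Ext¹(G, A) = 0` then every map `G → C` lifts to `B`. -/
lemma exists_lift (S : ShortExactSeq f g) {G : ModuleCat.{u} R} (hA : extVanish R 1 G A)
    (h : G →ₗ[R] C) : ∃ k : G →ₗ[R] B, g ∘ₗ k = h := by
  let := HasDerivedCategory.standard (ModuleCat.{u} R)
  let : HasExt.{u + 1} (ModuleCat.{u} R) := hasExt_of_hasDerivedCategory _
  replace hA : Subsingleton (Ext G A 1) := hA
  obtain ⟨y, hy⟩ := Ext.covariant_sequence_exact₃ G S.shortExact
    (Ext.mk₀ (ModuleCat.ofHom h)) (zero_add 1) (hA.elim _ _)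
  obtain ⟨k, rfl⟩ := (Ext.mk₀_bijective _ _).surjective y
  rw [Ext.mk₀_comp_mk₀] at hy
  exact ⟨k.hom, congrArg ModuleCat.Hom.hom ((Ext.mk₀_bijective _ _).injective hy)⟩

end ShortExactSeq

section Ext

variable {R : Type u} [Ring R]

open Abelian in
lemma extVanish_of_projective {P : ModuleCat.{u} R} (hP : Module.Projective R P)
    (N : ModuleCat.{u} R) (n : ℕ) : extVanish R (n + 1) P N := by
  let := HasDerivedCategory.standard (ModuleCat.{u} R)
  let : HasExt.{u + 1} (ModuleCat.{u} R) := hasExt_of_hasDerivedCategory _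
  exact subsingleton_of_forall_eq (0 : Ext P N (n + 1)) fun x => x.eq_zero_of_projective

open Abelian in
lemma extVanish_of_retract {X M N : ModuleCat.{u} R} {n : ℕ} (s : M →ₗ[R] X) (p : X →ₗ[R] M)
    (hps : p ∘ₗ s = LinearMap.id) (hX : extVanish R n X N) : extVanish R n M N := by
  let := HasDerivedCategory.standard (ModuleCat.{u} R)
  let : HasExt.{u + 1} (ModuleCat.{u} R) := hasExt_of_hasDerivedCategory _
  replace hX : Subsingleton (Ext X N n) := hX
  refine subsingleton_of_forall_eq (0 : Ext M N n) fun x => ?_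
  have h : ModuleCat.ofHom s ≫ ModuleCat.ofHom p = 𝟙 M := ModuleCat.hom_ext hps
  rw [← Ext.mk₀_id_comp x, ← h, ← Ext.mk₀_comp_mk₀_assoc,
    hX.elim ((Ext.mk₀ (ModuleCat.ofHom p)).comp x (zero_add n)) 0, Ext.comp_zero]

open Abelian in
lemma extVanish_congr_right {M N N' : ModuleCat.{u} R} {n : ℕ} (e : N ≃ₗ[R] N')
    (h : extVanish R n M N) : extVanish R n M N' := by
  let := HasDerivedCategory.standard (ModuleCat.{u} R)
  let : HasExt.{u + 1} (ModuleCat.{u} R) := hasExt_of_hasDerivedCategory _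
  replace h : Subsingleton (Ext M N n) := h
  refine subsingleton_of_forall_eq (0 : Ext M N' n) fun x => ?_
  have hx : (x.comp (Ext.mk₀ e.toModuleIso.inv) (add_zero n)).comp
      (Ext.mk₀ e.toModuleIso.hom) (add_zero n) = x := by
    rw [Ext.comp_assoc_of_third_deg_zero, Ext.mk₀_comp_mk₀, Iso.inv_hom_id, Ext.comp_mk₀_id]
  rw [← hx, h.elim (x.comp (Ext.mk₀ e.toModuleIso.inv) (add_zero n)) 0, Ext.zero_comp]

open Abelian in
/-- `Ext¹` can be tested on one projective presentation. -/
lemma extVanish_one_of_forall_extend {A B C N : ModuleCat.{u} R} {f : A →ₗ[R] B}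
    {g : B →ₗ[R] C} (S : ShortExactSeq f g) (hB : Module.Projective R B)
    (h : ∀ k : A →ₗ[R] N, ∃ l : B →ₗ[R] N, l ∘ₗ f = k) : extVanish R 1 C N := by
  have hB' := extVanish_of_projective hB N 0
  let := HasDerivedCategory.standard (ModuleCat.{u} R)
  let : HasExt.{u + 1} (ModuleCat.{u} R) := hasExt_of_hasDerivedCategory _
  replace hB' : Subsingleton (Ext B N 1) := hB'
  refine subsingleton_of_forall_eq (0 : Ext C N 1) fun x => ?_
  obtain ⟨y, rfl⟩ := Ext.contravariant_sequence_exact₃ S.shortExact N x (hB'.elim _ _)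
    (add_zero 1)
  obtain ⟨k, rfl⟩ := (Ext.mk₀_bijective _ _).surjective y
  obtain ⟨l, rfl⟩ : ∃ l : (ShortComplex.moduleCatMk f g S.comp_eq_zero).X₂ ⟶ N,
      (ShortComplex.moduleCatMk f g S.comp_eq_zero).f ≫ l = k := by
    obtain ⟨l, hl⟩ := h k.hom
    exact ⟨ModuleCat.ofHom l, ModuleCat.hom_ext hl⟩
  rw [← Ext.mk₀_comp_mk₀, ShortComplex.ShortExact.extClass_comp_assoc]
  rfl

end Ext

lemma exists_bi_infinite_chain {α : Type*} {r : α → α → Prop} {p q : α → Prop}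
    (hp : ∀ s, p s → ∃ t, p t ∧ r s t) (hq : ∀ t, q t → ∃ s, q s ∧ r s t)
    {x : α} (hpx : p x) (hqx : q x) :
    ∃ Z : ℤ → α, Z 1 = x ∧ ∀ i, r (Z i) (Z (i + 1)) := by
  choose! a ha using hp
  choose! b hb using hq
  have hpa (n : ℕ) : p (a^[n] x) := by
    induction n with
    | zero => exact hpx
    | succ n ih => rw [Function.iterate_succ_apply']; exact (ha _ ih).1
  have hqb (n : ℕ) : q (b^[n] x) := by
    induction n with
    | zero => exact hqx
    | succ n ih => rw [Function.iterate_succ_apply']; exact (hb _ ih).1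
  let Z : ℤ → α := fun
    | Int.ofNat n => a^[n] x
    | Int.negSucc n => b^[n + 1] x
  have hZ : ∀ i, r (Z i) (Z (i + 1)) := by
    rintro (n | _ | n)
    · change r (a^[n] x) (a^[n + 1] x)
      rw [Function.iterate_succ_apply']
      exact (ha _ (hpa n)).2
    · exact (hb _ hqx).2
    · change r (b^[n + 1 + 1] x) (b^[n + 1] x)
      rw [Function.iterate_succ_apply']
      exact (hb _ (hqb (n + 1))).2
  refine ⟨fun i => Z (i - 1), rfl, fun i => ?_⟩
  have h := hZ (i - 1)
  rwa [sub_add_eq_add_sub] at h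

/-- The modules `M` with `Ext^i(M, Q) = 0` for all `i ≥ 1` and all projective `Q`. -/
def ExtProjectiveVanish (R : Type u) [Ring R] (M : ModuleCat.{u} R) : Prop :=
  ∀ Q : ModuleCat.{u} R, Module.Projective R Q → ∀ n, extVanish R (n + 1) M Q

/-- There is a short exact sequence `0 → X → P → Y → 0` with `P` projective which remains exact
after applying `Hom(-, Q)` for each projective `Q`. -/
def IsCosyzygy (R : Type u) [Ring R] (X Y : ModuleCat.{u} R) : Prop :=
  ∃ (P : ModuleCat.{u} R) (f : X →ₗ[R] P) (g : P →ₗ[R] Y), Module.Projective R P ∧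
    ShortExactSeq f g ∧ ∀ Q : ModuleCat.{u} R, Module.Projective R Q → extVanish R 1 Y Q

/-- The modules arising as the image of some differential in a totally acyclic complex of
projective modules. -/
def IsTotallyAcyclicImage (R : Type u) [Ring R] (X : ModuleCat.{u} R) : Prop :=
  ∃ (P : ℤ → ModuleCat.{u} R) (d : ∀ i : ℤ, P i →ₗ[R] P (i + 1)),
    (∀ i, Module.Projective R (P i)) ∧
    (∀ i, LinearMap.range (d i) = LinearMap.ker (d (i + 1))) ∧
    (∃ i, Nonempty (X ≃ₗ[R] LinearMap.range (d i))) ∧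
    ∀ (Q : ModuleCat.{u} R), Module.Projective R Q →
      ∀ (i : ℤ) (f : P (i + 1) →ₗ[R] Q), f ∘ₗ d i = 0 →
        ∃ g : P (i + 1 + 1) →ₗ[R] Q, g ∘ₗ d (i + 1) = f

section GorensteinProjective

variable {R : Type u} [Ring R]

lemma IsGorensteinProjective.isTotallyAcyclicImage {X : ModuleCat.{u} R}
    (h : IsGorensteinProjective R X) : IsTotallyAcyclicImage R X := by
  obtain ⟨P, d, hP, hd, hX, hQ⟩ := h
  exact ⟨P, d, hP, hd, ⟨0, hX⟩, hQ⟩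

lemma isCosyzygy_of_range_eq_ker {X Y P₀ P₁ P₂ : ModuleCat.{u} R} {d₀ : P₀ →ₗ[R] P₁}
    {d₁ : P₁ →ₗ[R] P₂} (hP : Module.Projective R P₁)
    (hd : LinearMap.range d₀ = LinearMap.ker d₁)
    (hQ : ∀ Q : ModuleCat.{u} R, Module.Projective R Q → ∀ k : LinearMap.range d₀ →ₗ[R] Q,
      ∃ l : P₁ →ₗ[R] Q, l ∘ₗ d₀ = k ∘ₗ d₀.rangeRestrict)
    (eX : X ≃ₗ[R] LinearMap.range d₀) (eY : Y ≃ₗ[R] LinearMap.range d₁) : IsCosyzygy R X Y := by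
  have S : ShortExactSeq ((LinearMap.range d₀).subtype ∘ₗ eX.toLinearMap)
      (eY.symm.toLinearMap ∘ₗ d₁.rangeRestrict) :=
    { inj := Subtype.val_injective.comp eX.injective
      surj := eY.symm.surjective.comp d₁.surjective_rangeRestrict
      exact := by
        rw [LinearMap.range_comp_of_range_eq_top _ eX.range, Submodule.range_subtype,
          LinearMap.ker_comp_of_ker_eq_bot _ eY.symm.ker, LinearMap.ker_rangeRestrict, hd] }
  refine ⟨P₁, _, _, hP, S, fun Q hQp => extVanish_one_of_forall_extend S hP fun k => ?_⟩
  obtain ⟨l, hl⟩ := hQ Q hQp (k ∘ₗ eX.symm.toLinearMap)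
  refine ⟨l, LinearMap.ext fun x => ?_⟩
  obtain ⟨⟨_, p, rfl⟩, rfl⟩ := eX.symm.surjective x
  simpa using! LinearMap.congr_fun hl p

lemma IsTotallyAcyclicImage.exists_isCosyzygy {X : ModuleCat.{u} R}
    (h : IsTotallyAcyclicImage R X) :
    ∃ Y, IsTotallyAcyclicImage R Y ∧ IsCosyzygy R X Y := by
  obtain ⟨P, d, hP, hd, ⟨i, ⟨e⟩⟩, hQ⟩ := h
  obtain ⟨j, rfl⟩ : ∃ j, i = j + 1 := ⟨i - 1, by ring⟩
  refine ⟨ModuleCat.of R (LinearMap.range (d (j + 1 + 1))),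
    ⟨P, d, hP, hd, ⟨_, ⟨LinearEquiv.refl R _⟩⟩, hQ⟩,
    isCosyzygy_of_range_eq_ker (hP _) (hd _) (fun Q hQp k => hQ Q hQp j _ ?_) e
      (LinearEquiv.refl R _)⟩
  rw [LinearMap.comp_assoc, (LinearMap.range_le_ker_iff (g := (d (j + 1)).rangeRestrict)).1,
    LinearMap.comp_zero]
  rw [LinearMap.ker_rangeRestrict]
  exact (hd j).le

lemma IsTotallyAcyclicImage.exists_isCosyzygy_left {Y : ModuleCat.{u} R}
    (h : IsTotallyAcyclicImage R Y) :
    ∃ X, IsTotallyAcyclicImage R X ∧ IsCosyzygy R X Y := by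
  obtain ⟨P, d, hP, hd, ⟨i, ⟨e⟩⟩, hQ⟩ := h
  obtain ⟨j, rfl⟩ : ∃ j, i = j + 1 + 1 := ⟨i - 1 - 1, by ring⟩
  refine ⟨ModuleCat.of R (LinearMap.range (d (j + 1))),
    ⟨P, d, hP, hd, ⟨_, ⟨LinearEquiv.refl R _⟩⟩, hQ⟩,
    isCosyzygy_of_range_eq_ker (hP _) (hd _) (fun Q hQp k => hQ Q hQp j _ ?_)
      (LinearEquiv.refl R _) e⟩
  rw [LinearMap.comp_assoc, (LinearMap.range_le_ker_iff (g := (d (j + 1)).rangeRestrict)).1,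
    LinearMap.comp_zero]
  rw [LinearMap.ker_rangeRestrict]
  exact (hd j).le

lemma IsTotallyAcyclicImage.extProjectiveVanish {X : ModuleCat.{u} R}
    (h : IsTotallyAcyclicImage R X) : ExtProjectiveVanish R X := by
  intro Q hQ n
  induction n generalizing X with
  | zero =>
    obtain ⟨_, _, _, _, _, _, _, hX⟩ := h.exists_isCosyzygy_left
    exact hX Q hQ
  | succ n ih =>
    obtain ⟨_, hY, _, _, _, hP, S, -⟩ := h.exists_isCosyzygy_left
    exact S.extVanish_right (ih hY) (extVanish_of_projective hP _ _)

lemma ExtProjectiveVanish.exists_isCosyzygy_left {Y : ModuleCat.{u} R}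
    (h : ExtProjectiveVanish R Y) : ∃ X, ExtProjectiveVanish R X ∧ IsCosyzygy R X Y := by
  obtain ⟨K, P, f, g, hP, S⟩ := ShortExactSeq.of_projective_presentation Y
  exact ⟨K, fun Q hQ n => S.extVanish_left (extVanish_of_projective hP _ _) (h Q hQ _),
    P, f, g, hP, S, fun Q hQ => h Q hQ 0⟩

/-- A module is Gorenstein projective when `Ext^i(M, Q) = 0` for `i ≥ 1` and `Q` projective,
and it belongs to a class of modules all of which have a cosyzygy in the class. -/
lemma isGorensteinProjective_of_class {M : ModuleCat.{u} R} (hM : ExtProjectiveVanish R M)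
    (p : ModuleCat.{u} R → Prop) (hpM : p M)
    (hp : ∀ X, p X → ∃ Y, p Y ∧ IsCosyzygy R X Y) : IsGorensteinProjective R M := by
  obtain ⟨Z, rfl, hZ⟩ := exists_bi_infinite_chain hp
    (fun _ h => ExtProjectiveVanish.exists_isCosyzygy_left h) hpM hM
  choose P f g hP S hQ using hZ
  refine ⟨P, fun i => f (i + 1) ∘ₗ g i, hP, fun i => ?_, ⟨?_⟩, fun Q hQp i k hk => ?_⟩
  · rw [LinearMap.range_comp_of_range_eq_top _ (LinearMap.range_eq_top.2 (S i).surj),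
      LinearMap.ker_comp_of_ker_eq_bot _ (LinearMap.ker_eq_bot.2 (S _).inj), (S _).exact]
  · refine (LinearEquiv.ofInjective (f 1) (S 1).inj).trans (LinearEquiv.ofEq _ _ ?_)
    exact (LinearMap.range_comp_of_range_eq_top _ (LinearMap.range_eq_top.2 (S 0).surj)).symm
  · obtain ⟨l, rfl⟩ := (S (i + 1)).exists_desc k (LinearMap.ext fun x => by
      obtain ⟨y, rfl⟩ := (S i).surj x
      exact LinearMap.congr_fun hk y)
    obtain ⟨m, rfl⟩ := (S (i + 1 + 1)).exists_extend (hQ _ Q hQp) l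
    exact ⟨m, rfl⟩

lemma IsTotallyAcyclicImage.isGorensteinProjective {X : ModuleCat.{u} R}
    (h : IsTotallyAcyclicImage R X) : IsGorensteinProjective R X :=
  isGorensteinProjective_of_class h.extProjectiveVanish _ h fun _ h => h.exists_isCosyzygy

lemma IsGorensteinProjective.extProjectiveVanish {X : ModuleCat.{u} R}
    (h : IsGorensteinProjective R X) : ExtProjectiveVanish R X :=
  h.isTotallyAcyclicImage.extProjectiveVanish

lemma IsGorensteinProjective.exists_isCosyzygy {X : ModuleCat.{u} R}
    (h : IsGorensteinProjective R X) : ∃ Y, IsGorensteinProjective R Y ∧ IsCosyzygy R X Y := by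
  obtain ⟨Y, hY, h'⟩ := h.isTotallyAcyclicImage.exists_isCosyzygy
  exact ⟨Y, hY.isGorensteinProjective, h'⟩

lemma ShortExactSeq.extProjectiveVanish_mid {A B C : ModuleCat.{u} R} {f : A →ₗ[R] B}
    {g : B →ₗ[R] C} (S : ShortExactSeq f g) (hA : ExtProjectiveVanish R A)
    (hC : ExtProjectiveVanish R C) : ExtProjectiveVanish R B :=
  fun Q hQ n => S.extVanish_mid (hA Q hQ n) (hC Q hQ n)

namespace ShortExactSeq

lemma of_apply {A B C : ModuleCat.{u} R} {f : A →ₗ[R] B} {g : B →ₗ[R] C}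
    (hf : ∀ a, f a = 0 → a = 0) (hg : ∀ c, ∃ b, g b = c) (hgf : ∀ a, g (f a) = 0)
    (hex : ∀ b, g b = 0 → ∃ a, f a = b) : ShortExactSeq f g where
  inj := (injective_iff_map_eq_zero f).2 hf
  surj := hg
  exact := le_antisymm (by rintro _ ⟨a, rfl⟩; exact hgf a) hex

/-- The short exact sequence of cokernels associated with two composable monomorphisms. -/
lemma exists_quotient {W X M P G : ModuleCat.{u} R} {f : W →ₗ[R] X} {g : X →ₗ[R] M}
    {e : X →ₗ[R] P} {p : P →ₗ[R] G} (S : ShortExactSeq f g) (T : ShortExactSeq e p) :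
    ∃ (Z : ModuleCat.{u} R) (π : P →ₗ[R] Z) (i : M →ₗ[R] Z) (q : Z →ₗ[R] G),
      ShortExactSeq (e ∘ₗ f) π ∧ ShortExactSeq i q := by
  have U : ShortExactSeq (e ∘ₗ f) _ := of_injective (T.inj.comp S.inj)
  obtain ⟨i, hi⟩ := S.exists_desc ((LinearMap.range (e ∘ₗ f)).mkQ ∘ₗ e)
    (LinearMap.ext U.apply_apply)
  obtain ⟨q, hq⟩ := U.exists_desc p (LinearMap.ext fun w => T.apply_apply (f w))
  replace hi := LinearMap.congr_fun hi
  replace hq := LinearMap.congr_fun hq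
  refine ⟨_, _, i, q, U, of_apply (fun m hm => ?_) (fun y => ?_) (fun m => ?_) fun z hz => ?_⟩
  · obtain ⟨x, rfl⟩ := S.surj m
    obtain ⟨w, hw⟩ := U.exists_of_apply_eq_zero ((hi x).symm.trans hm)
    rw [← T.inj hw, S.apply_apply]
  · obtain ⟨x, rfl⟩ := T.surj y
    exact ⟨_, hq x⟩
  · obtain ⟨x, rfl⟩ := S.surj m
    exact (congrArg q (hi x)).trans ((hq _).trans (T.apply_apply x))
  · obtain ⟨y, rfl⟩ := U.surj z
    obtain ⟨x, rfl⟩ := T.exists_of_apply_eq_zero ((hq y).symm.trans hz)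
    exact ⟨g x, hi x⟩

/-- The short exact sequences obtained from a pushout of two monomorphisms. -/
lemma exists_pushout {A B C D E : ModuleCat.{u} R} {f : A →ₗ[R] B} {g : B →ₗ[R] C}
    {w : A →ₗ[R] D} {q : D →ₗ[R] E} (S : ShortExactSeq f g) (T : ShortExactSeq w q) :
    ∃ (X : ModuleCat.{u} R) (i : B →ₗ[R] X) (p : X →ₗ[R] E) (j : D →ₗ[R] X) (r : X →ₗ[R] C),
      ShortExactSeq i p ∧ ShortExactSeq j r := by
  let d : A →ₗ[R] ModuleCat.of R (B × D) := f.prod (-w)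
  have hd : Function.Injective d := fun x y h => S.inj (congrArg Prod.fst h)
  have U : ShortExactSeq d _ := of_injective hd
  obtain ⟨p, hp⟩ := U.exists_desc (q ∘ₗ LinearMap.snd R B D)
    (LinearMap.ext fun a => by simp [d, T.apply_apply])
  obtain ⟨r, hr⟩ := U.exists_desc (g ∘ₗ LinearMap.fst R B D)
    (LinearMap.ext fun a => by simp [d, S.apply_apply])
  replace hp := LinearMap.congr_fun hp
  replace hr := LinearMap.congr_fun hr
  let π : (B × D) →ₗ[R] _ := (LinearMap.range d).mkQ
  refine ⟨_, π ∘ₗ LinearMap.inl R B D, p, π ∘ₗ LinearMap.inr R B D, r,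
    of_apply (fun b hb => ?_) (fun e => ?_) (fun b => ?_) (fun x hx => ?_),
    of_apply (fun b hb => ?_) (fun e => ?_) (fun b => ?_) fun x hx => ?_⟩
  · obtain ⟨a, ha⟩ := U.exists_of_apply_eq_zero hb
    have h₁ : f a = b := congrArg Prod.fst ha
    have h₂ : -w a = 0 := congrArg Prod.snd ha
    obtain rfl : a = 0 := T.inj (by rw [neg_eq_zero.1 h₂, map_zero])
    rw [← h₁, map_zero]
  · obtain ⟨x, rfl⟩ := T.surj e
    exact ⟨_, hp (0, x)⟩
  · exact (hp (b, 0)).trans (map_zero q)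
  · obtain ⟨⟨b, x⟩, rfl⟩ := U.surj x
    obtain ⟨a, rfl⟩ := T.exists_of_apply_eq_zero ((hp (b, x)).symm.trans hx)
    refine ⟨b + f a, sub_eq_zero.1 ((map_sub π _ _).symm.trans (.trans ?_ (U.apply_apply a)))⟩
    exact congrArg π (Prod.ext (by simp [d]) (by simp [d]))
  · obtain ⟨a, ha⟩ := U.exists_of_apply_eq_zero hb
    have h₁ : f a = 0 := congrArg Prod.fst ha
    have h₂ : -w a = b := congrArg Prod.snd ha
    obtain rfl : a = 0 := S.inj (by rw [h₁, map_zero])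
    rw [← h₂, map_zero, neg_zero]
  · obtain ⟨x, rfl⟩ := S.surj e
    exact ⟨_, hr (x, 0)⟩
  · exact (hr (0, b)).trans (map_zero g)
  · obtain ⟨⟨b, x⟩, rfl⟩ := U.surj x
    obtain ⟨a, rfl⟩ := S.exists_of_apply_eq_zero ((hr (b, x)).symm.trans hx)
    refine ⟨x + w a, sub_eq_zero.1 ((map_sub π _ _).symm.trans (.trans ?_ (U.apply_apply (-a))))⟩
    exact congrArg π (Prod.ext (by simp [d]) (by simp [d]))

/-- The dual horseshoe lemma for cosyzygies. -/
lemma exists_isCosyzygy {A X B A' B' : ModuleCat.{u} R} {i : A →ₗ[R] X} {g : X →ₗ[R] B}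
    (S : ShortExactSeq i g) (hB : ExtProjectiveVanish R B) (hA' : IsCosyzygy R A A')
    (hB' : IsCosyzygy R B B') :
    ∃ (Y : ModuleCat.{u} R) (i' : A' →ₗ[R] Y) (g' : Y →ₗ[R] B'),
      ShortExactSeq i' g' ∧ IsCosyzygy R X Y := by
  obtain ⟨P, f₁, p₁, hP, S₁, h₁⟩ := hA'
  obtain ⟨Q, f₂, p₂, hQ, S₂, h₂⟩ := hB'
  obtain ⟨k, hk⟩ := S.exists_extend (hB P hP 0) f₁
  replace hk := LinearMap.congr_fun hk
  let j : X →ₗ[R] ModuleCat.of R (P × Q) := k.prod (f₂ ∘ₗ g)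
  have hj_zero : ∀ x p, j x = (p, 0) → p₁ p = 0 := by
    intro x p h
    have h₁ : k x = p := congrArg Prod.fst h
    have h₂ : f₂ (g x) = 0 := congrArg Prod.snd h
    obtain ⟨a, rfl⟩ := S.exists_of_apply_eq_zero (S₂.inj (h₂.trans (map_zero f₂).symm))
    rw [← h₁, ← S₁.apply_apply a, ← hk a]
    rfl
  have hj : Function.Injective j := by
    refine (injective_iff_map_eq_zero j).2 fun x h => ?_
    have h₁ : k x = 0 := congrArg Prod.fst h
    have h₂ : f₂ (g x) = 0 := congrArg Prod.snd h
    obtain ⟨a, rfl⟩ := S.exists_of_apply_eq_zero (S₂.inj (h₂.trans (map_zero f₂).symm))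
    obtain rfl : a = 0 := S₁.inj ((hk a).symm.trans (h₁.trans (map_zero f₁).symm))
    exact map_zero i
  have U : ShortExactSeq j _ := of_injective hj
  let π : (P × Q) →ₗ[R] _ := (LinearMap.range j).mkQ
  obtain ⟨i', hi'⟩ := S₁.exists_desc (π ∘ₗ LinearMap.inl R P Q) (LinearMap.ext fun a => by
    refine .trans (congrArg π ?_) (U.apply_apply (i a))
    exact Prod.ext (hk a).symm (by simp [j, S.apply_apply]))
  obtain ⟨g', hg'⟩ := U.exists_desc (p₂ ∘ₗ LinearMap.snd R P Q)
    (LinearMap.ext fun x => S₂.apply_apply (g x))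
  replace hi' := LinearMap.congr_fun hi'
  replace hg' := LinearMap.congr_fun hg'
  have V : ShortExactSeq i' g' := by
    refine of_apply (fun x hx => ?_) (fun y => ?_) (fun x => ?_) fun y hy => ?_
    · obtain ⟨p, rfl⟩ := S₁.surj x
      obtain ⟨x, hx⟩ := U.exists_of_apply_eq_zero ((hi' p).symm.trans hx)
      exact hj_zero x p hx
    · obtain ⟨q, rfl⟩ := S₂.surj y
      exact ⟨_, hg' (0, q)⟩
    · obtain ⟨p, rfl⟩ := S₁.surj x
      exact (congrArg g' (hi' p)).trans ((hg' (p, 0)).trans (map_zero p₂))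
    · obtain ⟨⟨p, q⟩, rfl⟩ := U.surj y
      obtain ⟨b, rfl⟩ := S₂.exists_of_apply_eq_zero ((hg' (p, q)).symm.trans hy)
      obtain ⟨x, rfl⟩ := S.surj b
      refine ⟨p₁ (p - k x), (hi' _).trans ?_⟩
      rw [eq_comm, ← sub_eq_zero]
      refine (map_sub π _ _).symm.trans (.trans ?_ (U.apply_apply x))
      exact congrArg π (Prod.ext (by simp [j]) (by simp [j]))
  exact ⟨_, i', g', V, _, j, _, inferInstanceAs (Module.Projective R (P × Q)), U,
    fun N hN => V.extVanish_mid (h₁ N hN) (h₂ N hN)⟩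

lemma isGorensteinProjective_mid {A X B : ModuleCat.{u} R} {i : A →ₗ[R] X} {g : X →ₗ[R] B}
    (S : ShortExactSeq i g) (hA : IsGorensteinProjective R A) (hB : IsGorensteinProjective R B) :
    IsGorensteinProjective R X := by
  refine isGorensteinProjective_of_class
    (S.extProjectiveVanish_mid hA.extProjectiveVanish hB.extProjectiveVanish)
    (fun X => ∃ (A B : ModuleCat.{u} R) (i : A →ₗ[R] X) (g : X →ₗ[R] B),
      ShortExactSeq i g ∧ IsGorensteinProjective R A ∧ IsGorensteinProjective R B)
    ⟨A, B, i, g, S, hA, hB⟩ ?_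
  rintro X ⟨A, B, i, g, S, hA, hB⟩
  obtain ⟨A', hA', hAA'⟩ := hA.exists_isCosyzygy
  obtain ⟨B', hB', hBB'⟩ := hB.exists_isCosyzygy
  obtain ⟨Y, i', g', S', h⟩ := S.exists_isCosyzygy hB.extProjectiveVanish hAA' hBB'
  exact ⟨Y, ⟨A', B', i', g', S', hA', hB'⟩, h⟩

end ShortExactSeq

/-- The modules of finite projective dimension. -/
inductive HasFiniteProjDim (R : Type u) [Ring R] : ModuleCat.{u} R → Prop
  | of_projective (P : ModuleCat.{u} R) (hP : Module.Projective R P) : HasFiniteProjDim R P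
  | of_shortExactSeq {K P M : ModuleCat.{u} R} (f : K →ₗ[R] P) (g : P →ₗ[R] M)
      (hP : Module.Projective R P) (S : ShortExactSeq f g) (hK : HasFiniteProjDim R K) :
      HasFiniteProjDim R M

lemma ExtProjectiveVanish.extVanish_of_hasFiniteProjDim {G W : ModuleCat.{u} R}
    (hG : ExtProjectiveVanish R G) (hW : HasFiniteProjDim R W) (n : ℕ) :
    extVanish R (n + 1) G W := by
  induction hW generalizing n with
  | of_projective P hP => exact hG P hP n
  | of_shortExactSeq f g hP S hK ih => exact S.extVanish_covariant_right (hG _ hP n) (ih _)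

lemma HasFiniteProjDim.projective {W : ModuleCat.{u} R} (hW : HasFiniteProjDim R W)
    (hG : ExtProjectiveVanish R W) : Module.Projective R W := by
  cases hW with
  | of_projective _ hP => exact hP
  | of_shortExactSeq f g _ S hK =>
    obtain ⟨s, hs⟩ := S.exists_lift (hG.extVanish_of_hasFiniteProjDim hK 0) LinearMap.id
    exact Module.Projective.of_split s g hs

/-- A module of finite Gorenstein projective dimension embeds into a module of finite projective
dimension with Gorenstein projective cokernel. -/
lemma gpdLE.exists_hull {n : ℕ} {M : ModuleCat.{u} R} (h : gpdLE R n M) :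
    ∃ (W G : ModuleCat.{u} R) (f : M →ₗ[R] W) (g : W →ₗ[R] G),
      ShortExactSeq f g ∧ HasFiniteProjDim R W ∧ IsGorensteinProjective R G := by
  induction n generalizing M with
  | zero =>
    obtain ⟨G, hG, P, f, g, hP, S, -⟩ := IsGorensteinProjective.exists_isCosyzygy h
    exact ⟨P, G, f, g, S, .of_projective P hP, hG⟩
  | succ n ih =>
    obtain ⟨K, G, f, g, hG, hf, hg, hfg, hK⟩ := h
    obtain ⟨W, G', w, q, T, hW, hG'⟩ := ih hK
    obtain ⟨X, i, p, j, r, S₁, S₂⟩ := ShortExactSeq.exists_pushout ⟨hf, hg, hfg⟩ T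
    obtain ⟨Y, hY, P, e, s, hP, S₃, -⟩ :=
      (S₁.isGorensteinProjective_mid hG hG').exists_isCosyzygy
    obtain ⟨Z, π, i', q', S₄, S₅⟩ := S₂.exists_quotient S₃
    exact ⟨Z, Y, i', q', S₅, .of_shortExactSeq _ π hP S₄ hW, hY⟩

lemma isGorensteinProjective_iff_extProjectiveVanish {n : ℕ}
    (h : ∀ M : ModuleCat.{u} R, gpdLE R n M) {M : ModuleCat.{u} R} :
    IsGorensteinProjective R M ↔ ExtProjectiveVanish R M := by
  refine ⟨fun hM => hM.extProjectiveVanish, fun hM =>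
    isGorensteinProjective_of_class hM _ hM fun X hX => ?_⟩
  obtain ⟨W, G, f, g, S, hW, hG⟩ := (h X).exists_hull
  exact ⟨G, hG.extProjectiveVanish, W, f, g,
    hW.projective (S.extProjectiveVanish_mid hX hG.extProjectiveVanish), S,
    fun Q hQ => hG.extProjectiveVanish Q hQ 0⟩

lemma exists_gorensteinProjective_cover {n : ℕ} (h : ∀ M : ModuleCat.{u} R, gpdLE R n M)
    (M : ModuleCat.{u} R) :
    ∃ (W G : ModuleCat.{u} R) (f : W →ₗ[R] G) (g : G →ₗ[R] M),
      ShortExactSeq f g ∧ HasFiniteProjDim R W ∧ IsGorensteinProjective R G := by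
  obtain ⟨K, P, f, g, hP, S⟩ := ShortExactSeq.of_projective_presentation M
  obtain ⟨W, G, w, q, T, hW, hG⟩ := (h K).exists_hull
  obtain ⟨X, i, p, j, r, S₁, S₂⟩ := S.exists_pushout T
  have hP' : IsGorensteinProjective R P :=
    (isGorensteinProjective_iff_extProjectiveVanish h).2
      fun Q _ n => extVanish_of_projective hP Q n
  exact ⟨W, X, j, r, S₂, hW, S₁.isGorensteinProjective_mid hP' hG⟩

end GorensteinProjective

/-- If the left Gorenstein global dimension of `R` is finite, then
`(GP(R), GP(R)^⊥)` is a complete hereditary cotorsion theory. -/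
theorem gp_complete_hereditary_cotorsion (R : Type u) [Ring R]
    (h : ∃ n : ℕ, ∀ M : ModuleCat.{u} R, gpdLE R n M) :
    -- `^⊥(GP(R)^⊥) = GP(R)`, so that `(GP(R), GP(R)^⊥)` is a cotorsion theory
    (∀ M : ModuleCat.{u} R,
      (∀ N : ModuleCat.{u} R, (∀ G, IsGorensteinProjective R G → extVanish R 1 G N) →
        extVanish R 1 M N) ↔ IsGorensteinProjective R M) ∧
    -- every module has a special `GP(R)`-precover
    (∀ M : ModuleCat.{u} R, ∃ (G : ModuleCat.{u} R) (φ : G →ₗ[R] M),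
      IsGorensteinProjective R G ∧
      (∀ G' : ModuleCat.{u} R, IsGorensteinProjective R G' →
        ∀ ψ : G' →ₗ[R] M, ∃ χ : G' →ₗ[R] G, φ ∘ₗ χ = ψ) ∧
      Function.Surjective φ ∧
      (∀ G', IsGorensteinProjective R G' →
        extVanish R 1 G' (ModuleCat.of R (LinearMap.ker φ)))) ∧
    -- every module has a special `GP(R)^⊥`-preenvelope
    (∀ M : ModuleCat.{u} R, ∃ (Y : ModuleCat.{u} R) (φ : M →ₗ[R] Y),
      (∀ G, IsGorensteinProjective R G → extVanish R 1 G Y) ∧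
      (∀ Y' : ModuleCat.{u} R, (∀ G, IsGorensteinProjective R G → extVanish R 1 G Y') →
        ∀ ψ : M →ₗ[R] Y', ∃ χ : Y →ₗ[R] Y', χ ∘ₗ φ = ψ) ∧
      Function.Injective φ ∧
      (∀ N : ModuleCat.{u} R, (∀ G, IsGorensteinProjective R G → extVanish R 1 G N) →
        extVanish R 1 (ModuleCat.of R (↥Y ⧸ LinearMap.range φ)) N)) ∧
    -- the cotorsion theory is hereditary
    (∀ (L' L L'' : ModuleCat.{u} R) (f : L' →ₗ[R] L) (g : L →ₗ[R] L''),
      Function.Injective f → Function.Surjective g → LinearMap.range f = LinearMap.ker g →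
      IsGorensteinProjective R L → IsGorensteinProjective R L'' →
      IsGorensteinProjective R L') := by
  obtain ⟨n, h⟩ := h
  refine ⟨fun M => ⟨fun hM => ?_, fun hM N hN => hN M hM⟩, fun M => ?_, fun M => ?_, ?_⟩
  · obtain ⟨W, G, f, g, S, hW, hG⟩ := exists_gorensteinProjective_cover h M
    obtain ⟨s, hs⟩ := S.exists_lift (hM W fun G' hG' =>
      hG'.extProjectiveVanish.extVanish_of_hasFiniteProjDim hW 0) LinearMap.id
    exact (isGorensteinProjective_iff_extProjectiveVanish h).2 fun Q hQ n =>
      extVanish_of_retract s g hs (hG.extProjectiveVanish Q hQ n)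
  · obtain ⟨W, G, f, g, S, hW, hG⟩ := exists_gorensteinProjective_cover h M
    have hW' (G' : ModuleCat.{u} R) (hG' : IsGorensteinProjective R G') (n : ℕ) :
        extVanish R (n + 1) G' W := hG'.extProjectiveVanish.extVanish_of_hasFiniteProjDim hW n
    let e : W ≃ₗ[R] LinearMap.ker g :=
      (LinearEquiv.ofInjective f S.inj).trans (LinearEquiv.ofEq _ _ S.exact)
    exact ⟨G, g, hG, fun G' hG' ψ => S.exists_lift (hW' G' hG' 0) ψ, S.surj, fun G' hG' =>
      extVanish_congr_right e (hW' G' hG' 0)⟩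
  · obtain ⟨W, G, f, g, S, hW, hG⟩ := (h M).exists_hull
    refine ⟨W, f, fun G' hG' => hG'.extProjectiveVanish.extVanish_of_hasFiniteProjDim hW 0,
      fun Y' hY' ψ => S.exists_extend (hY' G hG) ψ, S.inj, fun N hN => ?_⟩
    let e : (W ⧸ LinearMap.range f) ≃ₗ[R] G :=
      (Submodule.quotEquivOfEq _ _ S.exact).trans (g.quotKerEquivOfSurjective S.surj)
    exact extVanish_of_retract e.toLinearMap e.symm.toLinearMap (by ext; simp) (hN G hG)
  · intro L' L L'' f g hf hg hfg hL hL''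
    have S : ShortExactSeq f g := ⟨hf, hg, hfg⟩
    exact (isGorensteinProjective_iff_extProjectiveVanish h).2 fun Q hQ n =>
      S.extVanish_left (hL.extProjectiveVanish Q hQ n) (hL''.extProjectiveVanish Q hQ (n + 1))
end

section
/- If R is a ring with l.Ggldim(R) < ∞, then the pair (^⊥GI(R), GI(R)) is a complete hereditary cotorsion theory: (^⊥GI(R))^⊥ = GI(R), every R-module has a special ^⊥GI(R)-precover and a special GI(R)-preenvelope, and for every short exact sequence 0 → L' → L → L'' → 0 with L, L'' ∈ ^⊥GI(R) one has L' ∈ ^⊥GI(R). -/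
universe u

open CategoryTheory

/-- The sequence `0 → A → B → C → 0` with maps `f` and `g` is short exact. -/
structure IsShortExact {R : Type u} [Ring R] {A B C : ModuleCat.{u} R}
    (f : A →ₗ[R] B) (g : B →ₗ[R] C) : Prop where
  injective : Function.Injective f
  surjective : Function.Surjective g
  exact : Function.Exact f g

/-- Every morphism from `M` to the target of `g` lifts along `g`. -/
def LiftsAlong {R : Type u} [Ring R] {B C : ModuleCat.{u} R} (M : ModuleCat.{u} R)
    (g : B →ₗ[R] C) : Prop :=
  ∀ φ : M →ₗ[R] C, ∃ ψ : M →ₗ[R] B, g ∘ₗ ψ = φ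

/-- Every morphism from the source of `f` to `N` extends along `f`. -/
def ExtendsAlong {R : Type u} [Ring R] {A B : ModuleCat.{u} R} (f : A →ₗ[R] B)
    (N : ModuleCat.{u} R) : Prop :=
  ∀ φ : A →ₗ[R] N, ∃ ψ : B →ₗ[R] N, ψ ∘ₗ f = φ

section ExtCriteria

variable {R : Type u} [Ring R] {A B C M N : ModuleCat.{u} R}
  {f : A →ₗ[R] B} {g : B →ₗ[R] C}

theorem IsShortExact.apply_apply_eq_zero (h : IsShortExact f g) (a : A) : g (f a) = 0 :=
  h.exact.apply_apply_eq_zero a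

theorem IsShortExact.shortExact (h : IsShortExact f g) :
    (ShortComplex.mk (ModuleCat.ofHom f) (ModuleCat.ofHom g)
      (by ext x; exact h.apply_apply_eq_zero x)).ShortExact :=
  ModuleCat.shortComplex_shortExact _ h.exact h.injective h.surjective

theorem hasExt_succ (R : Type u) [Ring R] : HasExt.{u + 1} (ModuleCat.{u} R) :=
  letI := HasDerivedCategory.standard (ModuleCat.{u} R)
  hasExt_of_hasDerivedCategory _

attribute [local instance] hasExt_succ

theorem extVanish_iff {n : ℕ} :
    extVanish R n M N ↔ Subsingleton (Abelian.Ext.{u + 1} M N n) :=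
  Iff.rfl

theorem extVanish_one_of_injective [hN : Module.Injective R N] : extVanish R 1 M N := by
  have : Injective N := Module.injective_object_of_injective_module R N
  exact extVanish_iff.2 (Abelian.Ext.subsingleton_of_injective M N 0)

theorem extVanish_one_of_projective [hN : Module.Projective R M] : extVanish R 1 M N := by
  have : Projective M := (IsProjective.iff_projective (R := R) M).1 hN
  exact extVanish_iff.2 (Abelian.Ext.subsingleton_of_projective M N 0)

theorem IsShortExact.liftsAlong (h : IsShortExact f g) (hM : extVanish R 1 M A) :
    LiftsAlong M g := by
  intro φ
  rw [extVanish_iff] at hM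
  obtain ⟨ψ, hψ⟩ := Abelian.Ext.covariant_sequence_exact₃ M h.shortExact
    (Abelian.Ext.mk₀ (ModuleCat.ofHom φ)) rfl (Subsingleton.elim _ _)
  obtain ⟨ψ, rfl⟩ := (Abelian.Ext.mk₀_bijective _ _).2 ψ
  rw [Abelian.Ext.mk₀_comp_mk₀] at hψ
  exact ⟨ψ.hom, congrArg ModuleCat.Hom.hom ((Abelian.Ext.mk₀_bijective _ _).1 hψ)⟩

theorem IsShortExact.extendsAlong (h : IsShortExact f g) (hN : extVanish R 1 C N) :
    ExtendsAlong f N := by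
  intro φ
  rw [extVanish_iff] at hN
  obtain ⟨ψ, hψ⟩ := Abelian.Ext.contravariant_sequence_exact₁ h.shortExact N
    (Abelian.Ext.mk₀ (ModuleCat.ofHom φ)) rfl (Subsingleton.elim _ _)
  obtain ⟨ψ, rfl⟩ := (Abelian.Ext.mk₀_bijective _ _).2 ψ
  rw [Abelian.Ext.mk₀_comp_mk₀] at hψ
  exact ⟨ψ.hom, congrArg ModuleCat.Hom.hom ((Abelian.Ext.mk₀_bijective _ _).1 hψ)⟩

theorem IsShortExact.extVanish_left (h : IsShortExact f g) (hB : extVanish R 1 M B)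
    (hg : LiftsAlong M g) : extVanish R 1 M A := by
  rw [extVanish_iff] at hB ⊢
  refine subsingleton_of_forall_eq 0 fun x ↦ ?_
  obtain ⟨φ, rfl⟩ := Abelian.Ext.covariant_sequence_exact₁ M h.shortExact x
    (Subsingleton.elim _ _) (zero_add 1)
  obtain ⟨φ, rfl⟩ := (Abelian.Ext.mk₀_bijective _ _).2 φ
  obtain ⟨ψ, hψ⟩ := hg φ.hom
  obtain rfl : ModuleCat.ofHom ψ ≫ ModuleCat.ofHom g = φ := by ext x; simp [← hψ]
  rw [← Abelian.Ext.mk₀_comp_mk₀, Abelian.Ext.comp_assoc_of_second_deg_zero]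
  erw [h.shortExact.comp_extClass]
  simp

theorem IsShortExact.extVanish_right (h : IsShortExact f g) (hB : extVanish R 1 B N)
    (hf : ExtendsAlong f N) : extVanish R 1 C N := by
  rw [extVanish_iff] at hB ⊢
  refine subsingleton_of_forall_eq 0 fun x ↦ ?_
  obtain ⟨φ, rfl⟩ := Abelian.Ext.contravariant_sequence_exact₃ h.shortExact N x
    (Subsingleton.elim _ _) (add_zero 1)
  obtain ⟨φ, rfl⟩ := (Abelian.Ext.mk₀_bijective _ _).2 φ
  obtain ⟨ψ, hψ⟩ := hf φ.hom
  obtain rfl : ModuleCat.ofHom f ≫ ModuleCat.ofHom ψ = φ := by ext x; simp [← hψ]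
  rw [← Abelian.Ext.mk₀_comp_mk₀]
  erw [h.shortExact.extClass_comp_assoc]

theorem IsShortExact.extVanish_mid (h : IsShortExact f g) {n : ℕ} (hA : extVanish R n M A)
    (hC : extVanish R n M C) : extVanish R n M B := by
  rw [extVanish_iff] at *
  refine subsingleton_of_forall_eq 0 fun x ↦ ?_
  obtain ⟨y, rfl⟩ := Abelian.Ext.covariant_sequence_exact₂ M h.shortExact x
    (Subsingleton.elim _ _)
  rw [Subsingleton.elim y 0, Abelian.Ext.zero_comp]

end ExtCriteria

section ShortExactConstructions

variable {R : Type u} [Ring R]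

theorem isShortExact_mkQ {A B : ModuleCat.{u} R} {f : A →ₗ[R] B} (hf : Function.Injective f) :
    IsShortExact (C := ModuleCat.of R (B ⧸ LinearMap.range f)) f (LinearMap.range f).mkQ :=
  ⟨hf, Submodule.mkQ_surjective _, LinearMap.exact_map_mkQ_range f⟩

theorem isShortExact_ker {B C : ModuleCat.{u} R} {g : B →ₗ[R] C} (hg : Function.Surjective g) :
    IsShortExact (A := ModuleCat.of R (LinearMap.ker g)) (LinearMap.ker g).subtype g :=
  ⟨Subtype.val_injective, hg, LinearMap.exact_subtype_ker_map g⟩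

theorem exists_injective_isShortExact (M : ModuleCat.{u} R) :
    ∃ (J C : ModuleCat.{u} R) (f : M →ₗ[R] J) (g : J →ₗ[R] C),
      Module.Injective R J ∧ IsShortExact f g :=
  ⟨Injective.under M, _, (Injective.ι M).hom, _,
    Module.injective_module_of_injective_object R _ (inj := Injective.injective_under M),
    isShortExact_mkQ ((ModuleCat.mono_iff_injective _).1 inferInstance)⟩

theorem exists_projective_isShortExact (M : ModuleCat.{u} R) :
    ∃ (K P : ModuleCat.{u} R) (f : K →ₗ[R] P) (g : P →ₗ[R] M),
      Module.Projective R P ∧ IsShortExact f g :=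
  ⟨_, ModuleCat.of R (M →₀ R), _, Finsupp.linearCombination R id,
    inferInstanceAs (Module.Projective R (M →₀ R)),
    isShortExact_ker (Finsupp.linearCombination_id_surjective R M)⟩

theorem extendsAlong_of_injective {A B J : ModuleCat.{u} R} {f : A →ₗ[R] B}
    (hf : Function.Injective f) (hJ : Module.Injective R J) : ExtendsAlong f J := fun φ ↦
  have ⟨ψ, hψ⟩ := hJ.out f hf φ
  ⟨ψ, LinearMap.ext hψ⟩

theorem liftsAlong_of_projective {P B C : ModuleCat.{u} R} {g : B →ₗ[R] C}
    (hg : Function.Surjective g) (hP : Module.Projective R P) : LiftsAlong P g := fun φ ↦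
  Module.projective_lifting_property g φ hg

/-- A module map out of the middle term of a short exact sequence which vanishes on the first
term factors through the last term. -/
theorem IsShortExact.exists_desc {A B C : ModuleCat.{u} R} {f : A →ₗ[R] B} {g : B →ₗ[R] C}
    (h : IsShortExact f g) {N : ModuleCat.{u} R} (φ : B →ₗ[R] N) (hφ : φ ∘ₗ f = 0) :
    ∃ ψ : C →ₗ[R] N, ψ ∘ₗ g = φ := by
  have hker : LinearMap.ker g ≤ LinearMap.ker φ := by
    rw [h.exact.linearMap_ker_eq]
    rintro _ ⟨a, rfl⟩
    exact LinearMap.congr_fun hφ a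
  refine ⟨(LinearMap.ker g).liftQ φ hker ∘ₗ (g.quotKerEquivOfSurjective h.surjective).symm, ?_⟩
  ext b
  have : (g.quotKerEquivOfSurjective h.surjective).symm (g b) = (LinearMap.ker g).mkQ b := by
    rw [LinearEquiv.symm_apply_eq]; rfl
  simp [this]

theorem injective_of_retract {X J : ModuleCat.{u} R} (hJ : Module.Injective R J)
    (i : X →ₗ[R] J) (r : J →ₗ[R] X) (hr : r ∘ₗ i = LinearMap.id) : Module.Injective R X where
  out Y Z _ _ _ _ f hf φ := by
    obtain ⟨ψ, hψ⟩ := hJ.out f hf (i ∘ₗ φ)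
    refine ⟨r ∘ₗ ψ, fun y ↦ ?_⟩
    rw [LinearMap.comp_apply, hψ]
    exact LinearMap.congr_fun hr (φ y)

theorem injective_prod {I J : ModuleCat.{u} R} (hI : Module.Injective R I)
    (hJ : Module.Injective R J) : Module.Injective R (ModuleCat.of R (I × J)) where
  out Y Z _ _ _ _ f hf φ := by
    obtain ⟨ψ₁, h₁⟩ := hI.out f hf (LinearMap.fst R I J ∘ₗ φ)
    obtain ⟨ψ₂, h₂⟩ := hJ.out f hf (LinearMap.snd R I J ∘ₗ φ)
    exact ⟨ψ₁.prod ψ₂, fun y ↦ Prod.ext (h₁ y) (h₂ y)⟩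

/-- The pullback of a short exact sequence along a map into its last term. -/
theorem IsShortExact.exists_pullback {A B C D : ModuleCat.{u} R} {f : A →ₗ[R] B} {g : B →ₗ[R] C}
    (h : IsShortExact f g) (u : D →ₗ[R] C) :
    ∃ (X : ModuleCat.{u} R) (i : A →ₗ[R] X) (p : X →ₗ[R] D) (q : X →ₗ[R] B),
      IsShortExact i p ∧
      (Function.Surjective u → ∀ {K : ModuleCat.{u} R} {k : K →ₗ[R] D}, IsShortExact k u →
        ∃ j : K →ₗ[R] X, IsShortExact j q) ∧
      (∀ {L : ModuleCat.{u} R} {v : C →ₗ[R] L}, IsShortExact u v → IsShortExact q (v ∘ₗ g)) := by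
  let S : Submodule R (B × D) :=
    LinearMap.ker (g ∘ₗ LinearMap.fst R B D - u ∘ₗ LinearMap.snd R B D)
  have mem (b : B) (d : D) : (b, d) ∈ S ↔ g b = u d := by simp [S, sub_eq_zero]
  have eq (x : S) : g x.1.1 = u x.1.2 := (mem _ _).1 x.2
  refine ⟨ModuleCat.of R S,
    LinearMap.codRestrict S (LinearMap.inl R B D ∘ₗ f)
      fun a ↦ (mem _ _).2 (by simp [h.apply_apply_eq_zero]),
    LinearMap.snd R B D ∘ₗ S.subtype, LinearMap.fst R B D ∘ₗ S.subtype, ⟨?_, ?_, ?_⟩, ?_, ?_⟩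
  · intro a a' haa
    exact h.injective (congrArg (fun x : S ↦ x.1.1) haa)
  · intro d
    obtain ⟨b, hb⟩ := h.surjective (u d)
    exact ⟨⟨(b, d), (mem _ _).2 hb⟩, rfl⟩
  · rintro ⟨⟨b, d⟩, hx⟩
    constructor
    · rintro (rfl : d = 0)
      obtain ⟨a, rfl⟩ := (h.exact b).1 (by rw [(mem _ _).1 hx, map_zero])
      exact ⟨a, rfl⟩
    · rintro ⟨a, ha⟩
      exact (congrArg (fun x : S ↦ x.1.2) ha).symm
  · intro hu K k hk
    refine ⟨LinearMap.codRestrict S (LinearMap.inr R B D ∘ₗ k)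
      fun a ↦ (mem _ _).2 (by simp [hk.apply_apply_eq_zero]), ?_, ?_, ?_⟩
    · intro a a' haa
      exact hk.injective (congrArg (fun x : S ↦ x.1.2) haa)
    · intro b
      obtain ⟨d, hd⟩ := hu (g b)
      exact ⟨⟨(b, d), (mem _ _).2 hd.symm⟩, rfl⟩
    · rintro ⟨⟨b, d⟩, hx⟩
      constructor
      · rintro (rfl : b = 0)
        obtain ⟨a, rfl⟩ := (hk.exact d).1 (by rw [← (mem _ _).1 hx, map_zero])
        exact ⟨a, rfl⟩
      · rintro ⟨a, ha⟩
        exact (congrArg (fun x : S ↦ x.1.1) ha).symm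
  · intro L v hv
    refine ⟨?_, hv.surjective.comp h.surjective, ?_⟩
    · rintro ⟨⟨b, d⟩, hx⟩ ⟨⟨b', d'⟩, hx'⟩ (rfl : b = b')
      have : d = d' := hv.injective (((mem _ _).1 hx).symm.trans ((mem _ _).1 hx'))
      subst this
      rfl
    · intro b
      constructor
      · intro hb
        obtain ⟨d, hd⟩ := (hv.exact _).1 hb
        exact ⟨⟨(b, d), (mem _ _).2 hd.symm⟩, rfl⟩
      · rintro ⟨x, rfl⟩
        change v (g x.1.1) = 0
        rw [eq, hv.apply_apply_eq_zero]

end ShortExactConstructions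

section Links

variable {R : Type u} [Ring R]

/-- `A` and `B` are consecutive cocycle modules of a complex of injective modules which is exact
and remains exact under `Hom_R(E, −)` for injective `E`. -/
def IsInjectiveLink (A B : ModuleCat.{u} R) : Prop :=
  ∃ (J : ModuleCat.{u} R) (f : A →ₗ[R] J) (g : J →ₗ[R] B),
    Module.Injective R J ∧ IsShortExact f g ∧
      ∀ E : ModuleCat.{u} R, Module.Injective R E → LiftsAlong E g

theorem IsInjectiveLink.extVanish {A B E : ModuleCat.{u} R} (h : IsInjectiveLink A B)
    (hE : Module.Injective R E) : extVanish R 1 E A :=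
  have ⟨_, _, _, _, hfg, hg⟩ := h
  hfg.extVanish_left extVanish_one_of_injective (hg E hE)

theorem IsShortExact.isInjectiveLink {A J B : ModuleCat.{u} R} {f : A →ₗ[R] J} {g : J →ₗ[R] B}
    (h : IsShortExact f g) (hJ : Module.Injective R J)
    (hA : ∀ E : ModuleCat.{u} R, Module.Injective R E → extVanish R 1 E A) :
    IsInjectiveLink A B :=
  ⟨J, f, g, hJ, h, fun E hE ↦ h.liftsAlong (hA E hE)⟩

theorem IsInjectiveLink.congr {A A' B B' : ModuleCat.{u} R} (h : IsInjectiveLink A B)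
    (a : A' ≃ₗ[R] A) (b : B ≃ₗ[R] B') : IsInjectiveLink A' B' := by
  obtain ⟨J, f, g, hJ, hfg, hg⟩ := h
  refine ⟨J, f ∘ₗ a, b ∘ₗ g, hJ, ⟨hfg.injective.comp a.injective,
    b.surjective.comp hfg.surjective, fun x ↦ ?_⟩, fun E hE φ ↦ ?_⟩
  · simp only [LinearMap.comp_apply, LinearEquiv.coe_coe, LinearEquiv.map_eq_zero_iff]
    rw [hfg.exact x]
    exact (a.surjective.exists (p := fun y ↦ f y = x))
  · obtain ⟨ψ, hψ⟩ := hg E hE (b.symm ∘ₗ φ)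
    exact ⟨ψ, by rw [LinearMap.comp_assoc, hψ]; ext; simp⟩

/-- A relation in which every element has a successor and a predecessor admits a bi-infinite chain
through any given element. -/
theorem exists_int_chain {α : Type*} {r : α → α → Prop} (hs : ∀ a, ∃ b, r a b)
    (hp : ∀ a, ∃ b, r b a) (a : α) : ∃ F : ℤ → α, F 0 = a ∧ ∀ i, r (F i) (F (i + 1)) := by
  choose s hs using hs
  choose p hp using hp
  let F : ℤ → α
    | .ofNat n => s^[n] a
    | .negSucc n => p^[n + 1] a
  refine ⟨F, rfl, ?_⟩
  rintro (n | _ | n)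
  · change r (s^[n] a) (s^[n + 1] a)
    rw [Function.iterate_succ_apply']
    exact hs _
  · exact hp a
  · change r (p^[n + 2] a) (p^[n + 1] a)
    rw [Function.iterate_succ_apply']
    exact hp _

theorem isGorensteinInjective_of_chain {Z : ℤ → ModuleCat.{u} R}
    (hZ : ∀ i, IsInjectiveLink (Z i) (Z (i + 1))) (k : ℤ) : IsGorensteinInjective R (Z k) := by
  obtain ⟨F, hF, h⟩ : ∃ F : ℤ → ModuleCat.{u} R, F (0 + 1) = Z k ∧
      ∀ i, IsInjectiveLink (F i) (F (i + 1)) :=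
    ⟨fun i ↦ Z (i + (k - 1)), by simp, fun i ↦ by
      dsimp only; rw [add_right_comm]; exact hZ _⟩
  choose J f g hJ hfg hg using h
  rw [← hF]
  refine ⟨J, fun i ↦ f (i + 1) ∘ₗ g i, hJ, fun i ↦ ?_, ⟨?_⟩, fun E hE i φ hφ ↦ ?_⟩
  · rw [LinearMap.range_comp, LinearMap.range_eq_top.2 (hfg i).surjective, Submodule.map_top,
      LinearMap.ker_comp_of_ker_eq_bot _ (LinearMap.ker_eq_bot.2 (hfg _).injective),
      (hfg (i + 1)).exact.linearMap_ker_eq]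
  · exact LinearEquiv.ofInjective _ (hfg (0 + 1)).injective ≪≫ₗ LinearEquiv.ofEq _ _ (by
      rw [LinearMap.range_comp, LinearMap.range_eq_top.2 (hfg 0).surjective, Submodule.map_top])
  · have hker : ∀ e, φ e ∈ LinearMap.range (f (i + 1)) := fun e ↦ by
      rw [← (hfg (i + 1)).exact.linearMap_ker_eq]
      exact (hfg _).injective ((LinearMap.congr_fun hφ e).trans (map_zero _).symm)
    obtain ⟨ψ, hψ⟩ := hg i E hE ((LinearEquiv.ofInjective _ (hfg (i + 1)).injective).symm ∘ₗ
      φ.codRestrict _ hker)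
    refine ⟨ψ, ?_⟩
    rw [LinearMap.comp_assoc, hψ]
    ext e
    exact congrArg Subtype.val
      ((LinearEquiv.ofInjective _ (hfg (i + 1)).injective).apply_symm_apply ⟨φ e, hker e⟩)

theorem IsGorensteinInjective.exists_chain {G : ModuleCat.{u} R}
    (hG : IsGorensteinInjective R G) :
    ∃ Z : ℤ → ModuleCat.{u} R, (∀ i, IsInjectiveLink (Z i) (Z (i + 1))) ∧
      Nonempty (G ≃ₗ[R] Z 0) := by
  obtain ⟨I, d, hI, hd, he, hE⟩ := hG
  refine ⟨fun i ↦ ModuleCat.of R (LinearMap.range (d i)), fun i ↦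
    ⟨I (i + 1), (LinearMap.range (d i)).subtype, (d (i + 1)).rangeRestrict, hI _,
      ⟨Subtype.val_injective, LinearMap.surjective_rangeRestrict _, fun x ↦ ?_⟩,
      fun E hEI φ ↦ ?_⟩, he⟩
  · have := SetLike.ext_iff.1 (hd i) x
    rw [LinearMap.mem_ker] at this
    simpa [Subtype.ext_iff] using this.symm
  · obtain ⟨ψ, hψ⟩ := hE E hEI (i + 1) ((LinearMap.range (d (i + 1))).subtype ∘ₗ φ) (by
      ext e
      have : (φ e).1 ∈ LinearMap.ker (d (i + 1 + 1)) := hd (i + 1) ▸ (φ e).2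
      exact this)
    exact ⟨ψ, LinearMap.ext fun e ↦ Subtype.ext (LinearMap.congr_fun hψ e)⟩

/-- A class of modules closed under links in both directions consists of Gorenstein injective
modules. -/
theorem isGorensteinInjective_of_links {X : ModuleCat.{u} R → Prop}
    (hs : ∀ A, X A → ∃ B, X B ∧ IsInjectiveLink A B)
    (hp : ∀ A, X A → ∃ B, X B ∧ IsInjectiveLink B A) {G : ModuleCat.{u} R} (hG : X G) :
    IsGorensteinInjective R G := by
  obtain ⟨F, hF, h⟩ := exists_int_chain (α := {A // X A})
    (r := fun A B ↦ IsInjectiveLink A.1 B.1)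
    (fun A ↦ have ⟨B, hB, h⟩ := hs A.1 A.2; ⟨⟨B, hB⟩, h⟩)
    (fun A ↦ have ⟨B, hB, h⟩ := hp A.1 A.2; ⟨⟨B, hB⟩, h⟩) ⟨G, hG⟩
  simpa [hF] using isGorensteinInjective_of_chain (Z := fun i ↦ (F i).1) h 0

theorem IsGorensteinInjective.exists_succ {G : ModuleCat.{u} R}
    (hG : IsGorensteinInjective R G) :
    ∃ G' : ModuleCat.{u} R, IsGorensteinInjective R G' ∧ IsInjectiveLink G G' := by
  obtain ⟨Z, hZ, ⟨e⟩⟩ := hG.exists_chain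
  exact ⟨Z (0 + 1), isGorensteinInjective_of_chain hZ _, (hZ 0).congr e (LinearEquiv.refl _ _)⟩

theorem IsGorensteinInjective.exists_pred {G : ModuleCat.{u} R}
    (hG : IsGorensteinInjective R G) :
    ∃ G' : ModuleCat.{u} R, IsGorensteinInjective R G' ∧ IsInjectiveLink G' G := by
  obtain ⟨Z, hZ, ⟨e⟩⟩ := hG.exists_chain
  have h := hZ (-1)
  rw [neg_add_cancel] at h
  exact ⟨Z (-1), isGorensteinInjective_of_chain hZ _, h.congr (LinearEquiv.refl _ _) e.symm⟩

theorem IsGorensteinInjective.of_equiv {G G' : ModuleCat.{u} R}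
    (hG : IsGorensteinInjective R G) (e : G' ≃ₗ[R] G) : IsGorensteinInjective R G' :=
  have ⟨I, d, hI, hd, ⟨a⟩, hE⟩ := hG
  ⟨I, d, hI, hd, ⟨e ≪≫ₗ a⟩, hE⟩

theorem IsGorensteinInjective.extVanish {G E : ModuleCat.{u} R}
    (hG : IsGorensteinInjective R G) (hE : Module.Injective R E) : extVanish R 1 E G :=
  have ⟨_, _, h⟩ := hG.exists_succ
  h.extVanish hE

end Links

section Extensions

variable {R : Type u} [Ring R]

/-- A horseshoe construction: links out of the ends of a short exact sequence induce a link out of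
its middle term. -/
theorem exists_link_right_of_extension {A B C A' C' : ModuleCat.{u} R} {i : A →ₗ[R] B}
    {p : B →ₗ[R] C} (h : IsShortExact i p) (hA : IsInjectiveLink A A')
    (hC : IsInjectiveLink C C') :
    ∃ (B' : ModuleCat.{u} R) (i' : A' →ₗ[R] B') (p' : B' →ₗ[R] C'),
      IsShortExact i' p' ∧ IsInjectiveLink B B' := by
  have hB (E : ModuleCat.{u} R) (hE : Module.Injective R E) : extVanish R 1 E B :=
    h.extVanish_mid (hA.extVanish hE) (hC.extVanish hE)
  obtain ⟨I, f₁, g₁, hI, h₁, -⟩ := hA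
  obtain ⟨J, f₂, g₂, hJ, h₂, -⟩ := hC
  obtain ⟨k, hk⟩ := extendsAlong_of_injective h.injective hI f₁
  replace hk (a : A) : k (i a) = f₁ a := LinearMap.congr_fun hk a
  let F : B →ₗ[R] ModuleCat.of R (I × J) := k.prod (f₂ ∘ₗ p)
  have hF (b : B) : F b = (k b, f₂ (p b)) := rfl
  have hF_inj : Function.Injective F := by
    rw [← LinearMap.ker_eq_bot, LinearMap.ker_eq_bot']
    intro b hb
    rw [hF, Prod.mk_eq_zero] at hb
    obtain ⟨a, rfl⟩ := (h.exact b).1 (h₂.injective (hb.2.trans (map_zero _).symm))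
    rw [hk] at hb
    rw [h₁.injective (hb.1.trans (map_zero _).symm), map_zero]
  have hQ := isShortExact_mkQ hF_inj
  obtain ⟨i', hi'⟩ := h₁.exists_desc (N := ModuleCat.of R (ModuleCat.of R (I × J) ⧸
      LinearMap.range F)) ((LinearMap.range F).mkQ ∘ₗ LinearMap.inl R I J) (by
    ext a
    refine (Submodule.Quotient.mk_eq_zero _).2 ⟨i a, ?_⟩
    rw [hF, hk, h.apply_apply_eq_zero, map_zero]; rfl)
  obtain ⟨p', hp'⟩ := hQ.exists_desc (g₂ ∘ₗ LinearMap.snd R I J) (by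
    ext b
    exact h₂.apply_apply_eq_zero _)
  replace hi' (x : I) : i' (g₁ x) = (LinearMap.range F).mkQ (x, 0) := LinearMap.congr_fun hi' x
  replace hp' (z : I × J) : p' ((LinearMap.range F).mkQ z) = g₂ z.2 := LinearMap.congr_fun hp' z
  refine ⟨_, i', p', ⟨?_, fun c ↦ ?_, fun z ↦ ⟨fun hz ↦ ?_, ?_⟩⟩,
    hQ.isInjectiveLink (injective_prod hI hJ) hB⟩
  · rw [← LinearMap.ker_eq_bot, LinearMap.ker_eq_bot']
    intro a' ha'
    obtain ⟨x, rfl⟩ := h₁.surjective a'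
    rw [hi'] at ha'
    obtain ⟨b, hb⟩ := (Submodule.Quotient.mk_eq_zero _).1 ha'
    rw [hF, Prod.mk.injEq] at hb
    obtain ⟨a, rfl⟩ := (h.exact b).1 (h₂.injective (hb.2.trans (map_zero _).symm))
    rw [← hb.1, hk, h₁.apply_apply_eq_zero]
  · obtain ⟨y, rfl⟩ := h₂.surjective c
    exact ⟨(LinearMap.range F).mkQ (0, y), hp' _⟩
  · obtain ⟨⟨x, y⟩, rfl⟩ := hQ.surjective z
    obtain ⟨c, rfl⟩ := (h₂.exact y).1 ((hp' _).symm.trans hz)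
    obtain ⟨b, rfl⟩ := h.surjective c
    refine ⟨g₁ (x - k b), ?_⟩
    rw [hi']
    refine (Submodule.Quotient.eq _).2 ⟨-b, ?_⟩
    rw [map_neg, hF]
    ext <;> simp
  · rintro ⟨a', rfl⟩
    obtain ⟨x, rfl⟩ := h₁.surjective a'
    rw [hi', hp', map_zero]

/-- A horseshoe construction: links into the ends of a short exact sequence induce a link into
its middle term. -/
theorem exists_link_left_of_extension {A B C A' C' : ModuleCat.{u} R} {i : A →ₗ[R] B}
    {p : B →ₗ[R] C} (h : IsShortExact i p) (hA : IsInjectiveLink A' A)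
    (hC : IsInjectiveLink C' C)
    (hA₁ : ∀ E : ModuleCat.{u} R, Module.Injective R E → extVanish R 1 E A) :
    ∃ (B' : ModuleCat.{u} R) (i' : A' →ₗ[R] B') (p' : B' →ₗ[R] C'),
      IsShortExact i' p' ∧ IsInjectiveLink B' B := by
  have hA' (E : ModuleCat.{u} R) (hE : Module.Injective R E) := hA.extVanish hE
  have hC' (E : ModuleCat.{u} R) (hE : Module.Injective R E) := hC.extVanish hE
  obtain ⟨I, f₁, g₁, hI, h₁, -⟩ := hA
  obtain ⟨J, f₂, g₂, hJ, h₂, -⟩ := hC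
  obtain ⟨k, hk⟩ := h.liftsAlong (hA₁ J hJ) g₂
  replace hk (y : J) : p (k y) = g₂ y := LinearMap.congr_fun hk y
  let G : ModuleCat.of R (I × J) →ₗ[R] B := (i ∘ₗ g₁).coprod k
  have hG (z : I × J) : G z = i (g₁ z.1) + k z.2 := rfl
  have hpG (z : I × J) : p (G z) = g₂ z.2 := by
    rw [hG, map_add, h.apply_apply_eq_zero, zero_add, hk]
  have hG_surj : Function.Surjective G := by
    intro b
    obtain ⟨y, hy⟩ := h₂.surjective (p b)
    obtain ⟨a, ha⟩ := (h.exact (b - k y)).1 (by rw [map_sub, hk, hy, sub_self])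
    obtain ⟨x, rfl⟩ := h₁.surjective a
    exact ⟨(x, y), by rw [hG, ha, sub_add_cancel]⟩
  have hK := isShortExact_ker hG_surj
  have hker (z : LinearMap.ker G) : z.1.2 ∈ LinearMap.range f₂ := by
    rw [← h₂.exact.linearMap_ker_eq, LinearMap.mem_ker, ← hpG, LinearMap.mem_ker.1 z.2, map_zero]
  let e := LinearEquiv.ofInjective f₂ h₂.injective
  let p' : ModuleCat.of R (LinearMap.ker G) →ₗ[R] C' :=
    e.symm ∘ₗ (LinearMap.snd R I J ∘ₗ (LinearMap.ker G).subtype).codRestrict _ hker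
  have hp' (z : LinearMap.ker G) : f₂ (p' z) = z.1.2 :=
    congrArg Subtype.val (e.apply_symm_apply ⟨z.1.2, hker z⟩)
  have hK' : IsShortExact (B := ModuleCat.of R (LinearMap.ker G))
      ((LinearMap.inl R I J ∘ₗ f₁).codRestrict (LinearMap.ker G) fun a ↦ by
        rw [LinearMap.mem_ker, hG]; simp [h₁.apply_apply_eq_zero]) p' := by
    refine ⟨fun a a' haa ↦ h₁.injective (congrArg (fun z : LinearMap.ker G ↦ z.1.1) haa),
      fun c ↦ ?_, ?_⟩
    · obtain ⟨a, ha⟩ := (h.exact (k (f₂ c))).1 (by rw [hk, h₂.apply_apply_eq_zero])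
      obtain ⟨x, rfl⟩ := h₁.surjective a
      refine ⟨⟨(-x, f₂ c), ?_⟩, h₂.injective (hp' _)⟩
      rw [LinearMap.mem_ker, hG, map_neg, map_neg, ha, neg_add_cancel]
    · intro z
      have hz := LinearMap.mem_ker.1 z.2
      rw [hG] at hz
      constructor
      · intro hz'
        have h0 : z.1.2 = 0 := by rw [← hp', hz', map_zero]
        rw [h0, map_zero, add_zero] at hz
        obtain ⟨a, ha⟩ := (h₁.exact _).1 (h.injective (hz.trans (map_zero _).symm))
        exact ⟨a, Subtype.ext (Prod.ext ha h0.symm)⟩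
      · rintro ⟨a, rfl⟩
        exact h₂.injective ((hp' _).trans (map_zero _).symm)
  exact ⟨_, _, p', hK', hK.isInjectiveLink (injective_prod hI hJ)
    fun E hE ↦ hK'.extVanish_mid (hA' E hE) (hC' E hE)⟩

/-- Gorenstein injective modules are closed under extensions. -/
theorem IsShortExact.isGorensteinInjective {A B C : ModuleCat.{u} R} {i : A →ₗ[R] B}
    {p : B →ₗ[R] C} (h : IsShortExact i p) (hA : IsGorensteinInjective R A)
    (hC : IsGorensteinInjective R C) : IsGorensteinInjective R B := by
  refine isGorensteinInjective_of_links (X := fun B ↦ ∃ (A C : ModuleCat.{u} R) (i : A →ₗ[R] B)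
    (p : B →ₗ[R] C), IsGorensteinInjective R A ∧ IsGorensteinInjective R C ∧ IsShortExact i p)
    ?_ ?_ ⟨A, C, i, p, hA, hC, h⟩
  · rintro B ⟨A, C, i, p, hA, hC, h⟩
    obtain ⟨A', hA', lA⟩ := hA.exists_succ
    obtain ⟨C', hC', lC⟩ := hC.exists_succ
    obtain ⟨B', i', p', h', lB⟩ := exists_link_right_of_extension h lA lC
    exact ⟨B', ⟨A', C', i', p', hA', hC', h'⟩, lB⟩
  · rintro B ⟨A, C, i, p, hA, hC, h⟩
    obtain ⟨A', hA', lA⟩ := hA.exists_pred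
    obtain ⟨C', hC', lC⟩ := hC.exists_pred
    obtain ⟨B', i', p', h', lB⟩ := exists_link_left_of_extension h lA lC fun E hE ↦ hA.extVanish hE
    exact ⟨B', ⟨A', C', i', p', hA', hC', h'⟩, lB⟩

end Extensions

section CotorsionPair

variable {R : Type u} [Ring R]

/-- Membership in the left orthogonal class `^⊥GI(R)`. -/
def IsLeftOrthogonal (R : Type u) [Ring R] (M : ModuleCat.{u} R) : Prop :=
  ∀ G : ModuleCat.{u} R, IsGorensteinInjective R G → extVanish R 1 M G

theorem isLeftOrthogonal_of_injective {E : ModuleCat.{u} R} (hE : Module.Injective R E) :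
    IsLeftOrthogonal R E := fun _ hG ↦ hG.extVanish hE

theorem isLeftOrthogonal_of_projective {P : ModuleCat.{u} R} (hP : Module.Projective R P) :
    IsLeftOrthogonal R P := fun _ _ ↦ extVanish_one_of_projective

/-- The class `^⊥GI(R)` is closed under kernels of epimorphisms. -/
theorem IsShortExact.isLeftOrthogonal {L' L L'' : ModuleCat.{u} R} {f : L' →ₗ[R] L}
    {g : L →ₗ[R] L''} (h : IsShortExact f g) (hL : IsLeftOrthogonal R L)
    (hL'' : IsLeftOrthogonal R L'') : IsLeftOrthogonal R L' := by
  intro G hG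
  obtain ⟨G', hG', J, a, b, hJ, hab, -⟩ := hG.exists_succ
  refine hab.extVanish_left extVanish_one_of_injective fun φ ↦ ?_
  obtain ⟨ψ, rfl⟩ := h.extendsAlong (hL'' G' hG') φ
  obtain ⟨χ, rfl⟩ := hab.liftsAlong (hL G hG) ψ
  exact ⟨χ ∘ₗ f, rfl⟩

/-- The class `(^⊥GI(R))^⊥` is closed under cosyzygies. -/
theorem IsShortExact.extVanish_cosyzygy {N J N' : ModuleCat.{u} R} {f : N →ₗ[R] J}
    {g : J →ₗ[R] N'} (h : IsShortExact f g) (hJ : Module.Injective R J)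
    (hN : ∀ M : ModuleCat.{u} R, IsLeftOrthogonal R M → extVanish R 1 M N)
    (M : ModuleCat.{u} R) (hM : IsLeftOrthogonal R M) : extVanish R 1 M N' := by
  obtain ⟨K, P, a, b, hP, hab⟩ := exists_projective_isShortExact M
  refine hab.extVanish_right extVanish_one_of_projective fun φ ↦ ?_
  obtain ⟨ψ, rfl⟩ := h.liftsAlong
    (hN K (hab.isLeftOrthogonal (isLeftOrthogonal_of_projective hP) hM)) φ
  obtain ⟨χ, rfl⟩ := extendsAlong_of_injective hab.injective hJ ψ
  exact ⟨g ∘ₗ χ, rfl⟩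

theorem isLeftOrthogonal_of_subsingleton {M : ModuleCat.{u} R} [Subsingleton M] :
    IsLeftOrthogonal R M :=
  have := Module.Free.of_subsingleton R M
  isLeftOrthogonal_of_projective Module.Projective.of_free

theorem IsLeftOrthogonal.of_equiv {M M' : ModuleCat.{u} R} (hM : IsLeftOrthogonal R M)
    (e : M' ≃ₗ[R] M) : IsLeftOrthogonal R M' :=
  have h : IsShortExact (C := ModuleCat.of R PUnit) e.toLinearMap 0 :=
    ⟨e.injective, fun _ ↦ ⟨0, rfl⟩, fun x ↦ ⟨fun _ ↦ e.surjective x, fun _ ↦ rfl⟩⟩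
  h.isLeftOrthogonal hM isLeftOrthogonal_of_subsingleton

/-- A module of finite Gorenstein injective dimension embeds into a Gorenstein injective module
with cokernel in `^⊥GI(R)`. -/
theorem exists_embedding_of_gidLE (n : ℕ) (M : ModuleCat.{u} R) (hM : gidLE R n M) :
    ∃ (Y L : ModuleCat.{u} R) (f : M →ₗ[R] Y) (g : Y →ₗ[R] L),
      IsGorensteinInjective R Y ∧ IsLeftOrthogonal R L ∧ IsShortExact f g := by
  induction n generalizing M with
  | zero =>
    exact ⟨M, ModuleCat.of R PUnit, LinearMap.id, 0, hM, isLeftOrthogonal_of_subsingleton,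
      Function.injective_id, fun _ ↦ ⟨0, rfl⟩, fun x ↦ ⟨fun _ ↦ ⟨x, rfl⟩, fun _ ↦ rfl⟩⟩
  | succ n ih =>
    obtain ⟨G, C, f, g, hG, hf, hg, hfg, hC⟩ := hM
    have h : IsShortExact f g := ⟨hf, hg, LinearMap.exact_iff.2 hfg.symm⟩
    obtain ⟨G₁, L₁, a, b, hG₁, hL₁, hab⟩ := ih C hC
    obtain ⟨G₂, hG₂, E, c, d, hE, hcd, -⟩ := hG₁.exists_pred
    obtain ⟨X, i, p, q, hip, -, hX⟩ := hcd.exists_pullback a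
    have hXL : IsLeftOrthogonal R X :=
      (hX hab).isLeftOrthogonal (isLeftOrthogonal_of_injective hE) hL₁
    obtain ⟨Y, i', p', q', hip', hY, -⟩ := hip.exists_pullback g
    obtain ⟨j, hj⟩ := hY hg h
    exact ⟨Y, X, j, q', hip'.isGorensteinInjective hG₂ hG, hXL, hj⟩

/-- A module `M` which embeds into a Gorenstein injective module with cokernel `L` in `^⊥GI(R)` is
a quotient of a module `X` in `^⊥GI(R)` with Gorenstein injective kernel; moreover `X` embeds into
an injective module with cokernel `L`. -/
theorem exists_cover_of_embedding {M Y L : ModuleCat.{u} R} {f : M →ₗ[R] Y} {g : Y →ₗ[R] L}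
    (hY : IsGorensteinInjective R Y) (hL : IsLeftOrthogonal R L) (h : IsShortExact f g) :
    ∃ (K X I : ModuleCat.{u} R) (i : K →ₗ[R] X) (p : X →ₗ[R] M) (q : X →ₗ[R] I)
      (r : I →ₗ[R] L), IsGorensteinInjective R K ∧ IsLeftOrthogonal R X ∧
        Module.Injective R I ∧ IsShortExact i p ∧ IsShortExact q r := by
  obtain ⟨K, hK, I, c, d, hI, hcd, -⟩ := hY.exists_pred
  obtain ⟨X, i, p, q, hip, -, hX⟩ := hcd.exists_pullback f
  exact ⟨K, X, I, i, p, q, _, hK,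
    (hX h).isLeftOrthogonal (isLeftOrthogonal_of_injective hI) hL, hI, hip, hX h⟩

/-- If every module embeds into a Gorenstein injective module with cokernel in `^⊥GI(R)`, then
`(^⊥GI(R))^⊥` is contained in `GI(R)`. -/
theorem isGorensteinInjective_of_extVanish
    (hemb : ∀ M : ModuleCat.{u} R, ∃ (Y L : ModuleCat.{u} R) (f : M →ₗ[R] Y) (g : Y →ₗ[R] L),
      IsGorensteinInjective R Y ∧ IsLeftOrthogonal R L ∧ IsShortExact f g)
    {N : ModuleCat.{u} R}
    (hN : ∀ M : ModuleCat.{u} R, IsLeftOrthogonal R M → extVanish R 1 M N) :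
    IsGorensteinInjective R N := by
  refine isGorensteinInjective_of_links
    (X := fun N ↦ ∀ M, IsLeftOrthogonal R M → extVanish R 1 M N) (fun N hN ↦ ?_)
    (fun N hN ↦ ?_) hN
  · obtain ⟨J, N', f, g, hJ, h⟩ := exists_injective_isShortExact N
    exact ⟨N', h.extVanish_cosyzygy hJ hN,
      h.isInjectiveLink hJ fun E hE ↦ hN E (isLeftOrthogonal_of_injective hE)⟩
  · obtain ⟨Y, L, f, g, hY, hL, h⟩ := hemb N
    obtain ⟨K, X, I, i, p, q, r, hK, hX, hI, hip, hqr⟩ := exists_cover_of_embedding hY hL h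
    obtain ⟨s, hs⟩ := hqr.extendsAlong (hip.extVanish_mid (hL K hK)
      (hN L hL)) LinearMap.id
    exact ⟨K, fun M hM ↦ hM K hK, hip.isInjectiveLink (injective_of_retract hI q s hs)
      fun E hE ↦ hK.extVanish hE⟩

end CotorsionPair

/-- If the left Gorenstein global dimension of `R` is finite, then
`(^⊥GI(R), GI(R))` is a complete hereditary cotorsion theory. -/
theorem gi_complete_hereditary_cotorsion (R : Type u) [Ring R]
    (h : ∃ n : ℕ, ∀ M : ModuleCat.{u} R, gidLE R n M) :
    -- `(^⊥GI(R))^⊥ = GI(R)`, so that `(^⊥GI(R), GI(R))` is a cotorsion theory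
    (∀ N : ModuleCat.{u} R,
      (∀ M : ModuleCat.{u} R, (∀ G, IsGorensteinInjective R G → extVanish R 1 M G) →
        extVanish R 1 M N) ↔ IsGorensteinInjective R N) ∧
    -- every module has a special `^⊥GI(R)`-precover
    (∀ M : ModuleCat.{u} R, ∃ (X : ModuleCat.{u} R) (φ : X →ₗ[R] M),
      (∀ G, IsGorensteinInjective R G → extVanish R 1 X G) ∧
      (∀ X' : ModuleCat.{u} R, (∀ G, IsGorensteinInjective R G → extVanish R 1 X' G) →
        ∀ ψ : X' →ₗ[R] M, ∃ χ : X' →ₗ[R] X, φ ∘ₗ χ = ψ) ∧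
      Function.Surjective φ ∧
      (∀ M' : ModuleCat.{u} R, (∀ G, IsGorensteinInjective R G → extVanish R 1 M' G) →
        extVanish R 1 M' (ModuleCat.of R (LinearMap.ker φ)))) ∧
    -- every module has a special `GI(R)`-preenvelope
    (∀ M : ModuleCat.{u} R, ∃ (Y : ModuleCat.{u} R) (φ : M →ₗ[R] Y),
      IsGorensteinInjective R Y ∧
      (∀ Y' : ModuleCat.{u} R, IsGorensteinInjective R Y' →
        ∀ ψ : M →ₗ[R] Y', ∃ χ : Y →ₗ[R] Y', χ ∘ₗ φ = ψ) ∧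
      Function.Injective φ ∧
      (∀ G, IsGorensteinInjective R G →
        extVanish R 1 (ModuleCat.of R (↥Y ⧸ LinearMap.range φ)) G)) ∧
    -- the cotorsion theory is hereditary
    (∀ (L' L L'' : ModuleCat.{u} R) (f : L' →ₗ[R] L) (g : L →ₗ[R] L''),
      Function.Injective f → Function.Surjective g → LinearMap.range f = LinearMap.ker g →
      (∀ G, IsGorensteinInjective R G → extVanish R 1 L G) →
      (∀ G, IsGorensteinInjective R G → extVanish R 1 L'' G) →
      (∀ G, IsGorensteinInjective R G → extVanish R 1 L' G)) := by
  obtain ⟨n, hn⟩ := h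
  have hemb (M : ModuleCat.{u} R) := exists_embedding_of_gidLE n M (hn M)
  refine ⟨fun N ↦ ⟨isGorensteinInjective_of_extVanish hemb, fun hN M hM ↦ hM N hN⟩,
    fun M ↦ ?_, fun M ↦ ?_, fun L' L L'' f g hf hg hfg hL hL'' ↦
      IsShortExact.isLeftOrthogonal ⟨hf, hg, LinearMap.exact_iff.2 hfg.symm⟩ hL hL''⟩
  · obtain ⟨Y, L, f, g, hY, hL, h⟩ := hemb M
    obtain ⟨K, X, I, i, p, q, r, hK, hX, hI, hip, hqr⟩ := exists_cover_of_embedding hY hL h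
    refine ⟨X, p, hX, fun X' hX' ↦ hip.liftsAlong (hX' K hK), hip.surjective, fun M' hM' ↦ ?_⟩
    exact hM' _ (hK.of_equiv (LinearEquiv.ofEq _ _ hip.exact.linearMap_ker_eq ≪≫ₗ
      (LinearEquiv.ofInjective i hip.injective).symm))
  · obtain ⟨Y, L, f, g, hY, hL, h⟩ := hemb M
    refine ⟨Y, f, hY, fun Y' hY' ↦ h.extendsAlong (hL Y' hY'), h.injective, fun G hG ↦ ?_⟩
    exact hL.of_equiv (h.exact.linearEquivOfSurjective h.surjective) G hG
end
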